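/- Let I ⊂ ℝ be a bounded open interval such that the restriction of θ to I is not constant, and assume ω is not rotationally symmetric with respect to the origin, in the strong sense that there exists an angle ϑ ∈ (0,2π) such that the rotation of ω by ϑ about the origin differs from ω on a set of positive Lebesgue measure. Then λ(θ̇,I) > 0. -/

import Mathlib

open MeasureTheory Real Set Filter

noncomputable section

/-- First partial derivative ∂₁ of a function on ℝ³ = ℝ × ℝ × ℝ. -/
def pd1 {E : Type*} [NormedAddCommGroup E] [NormedSpace ℝ E]
    (ψ : ℝ × ℝ × ℝ → E) (x : ℝ × ℝ × ℝ) : E :=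
  deriv (fun t => ψ (t, x.2.1, x.2.2)) x.1

/-- Second partial derivative ∂₂. -/
def pd2 {E : Type*} [NormedAddCommGroup E] [NormedSpace ℝ E]
    (ψ : ℝ × ℝ × ℝ → E) (x : ℝ × ℝ × ℝ) : E :=
  deriv (fun t => ψ (x.1, t, x.2.2)) x.2.1

/-- Third partial derivative ∂₃. -/
def pd3 {E : Type*} [NormedAddCommGroup E] [NormedSpace ℝ E]
    (ψ : ℝ × ℝ × ℝ → E) (x : ℝ × ℝ × ℝ) : E :=
  deriv (fun t => ψ (x.1, x.2.1, t)) x.2.2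

/-- Transverse angular derivative ∂_τ = x₃∂₂ − x₂∂₃. -/
def pdtau {E : Type*} [NormedAddCommGroup E] [NormedSpace ℝ E]
    (ψ : ℝ × ℝ × ℝ → E) (x : ℝ × ℝ × ℝ) : E :=
  x.2.2 • pd2 ψ x - x.2.1 • pd3 ψ x

/-- The straight tube Ω₀ = ℝ × ω. -/
def Omega0 (ω : Set (ℝ × ℝ)) : Set (ℝ × ℝ × ℝ) := {x | x.2 ∈ ω}

/-- Smooth compactly supported test functions with support in Ω (i.e. C_c^∞(Ω)). -/
def IsTest3 {E : Type*} [NormedAddCommGroup E] [NormedSpace ℝ E]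
    (Ω : Set (ℝ × ℝ × ℝ)) (ψ : ℝ × ℝ × ℝ → E) : Prop :=
  ContDiff ℝ (⊤ : ℕ∞) ψ ∧ HasCompactSupport ψ ∧ tsupport ψ ⊆ Ω

/-- Partial derivatives on ℝ². -/
def pd1' (f : ℝ × ℝ → ℂ) (p : ℝ × ℝ) : ℂ := deriv (fun t => f (t, p.2)) p.1

def pd2' (f : ℝ × ℝ → ℂ) (p : ℝ × ℝ) : ℂ := deriv (fun t => f (p.1, t)) p.2

/-- Smooth compactly supported test functions on the cross-section, C_c^∞(ω). -/
def IsTest2 (ω : Set (ℝ × ℝ)) (f : ℝ × ℝ → ℂ) : Prop :=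
  ContDiff ℝ (⊤ : ℕ∞) f ∧ HasCompactSupport f ∧ tsupport f ⊆ ω

/-- The lowest Dirichlet eigenvalue E₁ of −Δ on ω, defined variationally. -/
def E1 (ω : Set (ℝ × ℝ)) : ℝ :=
  sInf { r : ℝ | ∃ f : ℝ × ℝ → ℂ, IsTest2 ω f ∧ f ≠ 0 ∧
    r = (∫ p in ω, (‖pd1' f p‖ ^ 2 + ‖pd2' f p‖ ^ 2)) / ∫ p in ω, ‖f p‖ ^ 2 }

/-- The twisted quadratic form Q_θ[ψ] = ∫_{Ω₀} (|∂₁ψ − θ̇ ∂_τψ|² + |∇'ψ|²). -/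
def Qform (θ : ℝ → ℝ) (ω : Set (ℝ × ℝ)) (ψ : ℝ × ℝ × ℝ → ℂ) : ℝ :=
  ∫ x in Omega0 ω,
    (‖pd1 ψ x - deriv θ x.1 • pdtau ψ x‖ ^ 2 + ‖pd2 ψ x‖ ^ 2 + ‖pd3 ψ x‖ ^ 2)

/-- Rotation of the plane by angle ϑ about the origin. -/
def rot (ϑ : ℝ) (p : ℝ × ℝ) : ℝ × ℝ :=
  (p.1 * Real.cos ϑ + p.2 * Real.sin ϑ, -p.1 * Real.sin ϑ + p.2 * Real.cos ϑ)

/-- The tube is twisted: θ is not constant and ω is not rotationally symmetric about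
the origin (in the strong sense: some rotated copy of ω differs from ω on a set of
positive Lebesgue measure). -/
def Twisted (θ : ℝ → ℝ) (ω : Set (ℝ × ℝ)) : Prop :=
  (∃ s t : ℝ, θ s ≠ θ t) ∧
  (∃ ϑ ∈ Set.Ioo (0 : ℝ) (2 * Real.pi), volume (symmDiff (rot ϑ '' ω) ω) ≠ 0)

/-- The tube is untwisted: θ is constant or ω is invariant under every rotation
about the origin. -/
def Untwisted (θ : ℝ → ℝ) (ω : Set (ℝ × ℝ)) : Prop :=
  (∀ s t : ℝ, θ s = θ t) ∨ (∀ ϑ : ℝ, rot ϑ '' ω = ω)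

/-- The quadratic form Q_θ^I on the bounded tube I × ω. -/
def QformI (θ : ℝ → ℝ) (ω : Set (ℝ × ℝ)) (I : Set ℝ) (ψ : ℝ × ℝ × ℝ → ℂ) : ℝ :=
  ∫ x in I ×ˢ ω,
    (‖pd1 ψ x - deriv θ x.1 • pdtau ψ x‖ ^ 2 + ‖pd2 ψ x‖ ^ 2 + ‖pd3 ψ x‖ ^ 2)

/-- λ(θ̇, I): the infimum of the shifted Rayleigh quotient of H_θ^I − E₁ over
nonzero restrictions to I × ω of functions in C_c^∞(Ω₀). -/
def lam (θ : ℝ → ℝ) (ω : Set (ℝ × ℝ)) (I : Set ℝ) : ℝ :=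
  sInf { r : ℝ | ∃ ψ : ℝ × ℝ × ℝ → ℂ, IsTest3 (Omega0 ω) ψ ∧
    (0 < ∫ x in I ×ˢ ω, ‖ψ x‖ ^ 2) ∧
    r = (QformI θ ω I ψ - E1 ω * ∫ x in I ×ˢ ω, ‖ψ x‖ ^ 2) /
          ∫ x in I ×ˢ ω, ‖ψ x‖ ^ 2 }

/-- The density `|∂₁f|² + |∂₂f|²` of the planar Dirichlet form. -/
def gradSq (f : ℝ × ℝ → ℂ) (p : ℝ × ℝ) : ℝ := ‖pd1' f p‖ ^ 2 + ‖pd2' f p‖ ^ 2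

lemma gradSq_nonneg (f : ℝ × ℝ → ℂ) (p : ℝ × ℝ) : 0 ≤ gradSq f p := by
  unfold gradSq; positivity

lemma integrableOn_of_continuous_of_isBounded {X E : Type*} [MetricSpace X] [ProperSpace X]
    [MeasurableSpace X] [OpensMeasurableSpace X] [NormedAddCommGroup E]
    {μ : Measure X} [IsFiniteMeasureOnCompacts μ] {f : X → E} (hf : Continuous f)
    {s : Set X} (hs : Bornology.IsBounded s) : IntegrableOn f s μ :=
  (hf.continuousOn.integrableOn_compact hs.isCompact_closure).mono_set subset_closure

lemma hasDerivAt_slice_fst {F : Type*} [NormedAddCommGroup F] [NormedSpace ℝ F]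
    {f : ℝ × ℝ → F} {p : ℝ × ℝ} (hf : DifferentiableAt ℝ f p) :
    HasDerivAt (fun t => f (t, p.2)) (fderiv ℝ f p (1, 0)) p.1 :=
  HasFDerivAt.comp_hasDerivAt (f := fun t => (t, p.2)) p.1 hf.hasFDerivAt
    ((hasDerivAt_id _).prodMk (hasDerivAt_const _ _))

lemma hasDerivAt_slice_snd {F : Type*} [NormedAddCommGroup F] [NormedSpace ℝ F]
    {f : ℝ × ℝ → F} {p : ℝ × ℝ} (hf : DifferentiableAt ℝ f p) :
    HasDerivAt (fun t => f (p.1, t)) (fderiv ℝ f p (0, 1)) p.2 :=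
  HasFDerivAt.comp_hasDerivAt (f := fun t => (p.1, t)) p.2 hf.hasFDerivAt
    ((hasDerivAt_const _ _).prodMk (hasDerivAt_id _))

lemma pd1'_eq_fderiv {f : ℝ × ℝ → ℂ} {p : ℝ × ℝ} (hf : DifferentiableAt ℝ f p) :
    pd1' f p = fderiv ℝ f p (1, 0) := (hasDerivAt_slice_fst hf).deriv

lemma pd2'_eq_fderiv {f : ℝ × ℝ → ℂ} {p : ℝ × ℝ} (hf : DifferentiableAt ℝ f p) :
    pd2' f p = fderiv ℝ f p (0, 1) := (hasDerivAt_slice_snd hf).deriv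

lemma continuous_gradSq {f : ℝ × ℝ → ℂ} (hf : ContDiff ℝ (⊤ : ℕ∞) f) :
    Continuous (gradSq f) := by
  have hd : Differentiable ℝ f := hf.differentiable (by simp)
  have h : gradSq f = fun p => ‖fderiv ℝ f p (1, 0)‖ ^ 2 + ‖fderiv ℝ f p (0, 1)‖ ^ 2 := by
    funext p
    rw [gradSq, pd1'_eq_fderiv (hd p), pd2'_eq_fderiv (hd p)]
  have hc : Continuous (fderiv ℝ f) := hf.continuous_fderiv (by simp)
  rw [h]
  fun_prop

lemma E1_nonneg (ω : Set (ℝ × ℝ)) : 0 ≤ E1 ω := by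
  apply Real.sInf_nonneg
  rintro r ⟨f, -, -, rfl⟩
  positivity

lemma E1_mul_le (ω : Set (ℝ × ℝ)) {f : ℝ × ℝ → ℂ} (hf : IsTest2 ω f) :
    E1 ω * ∫ p in ω, ‖f p‖ ^ 2 ≤ ∫ p in ω, gradSq f p := by
  have hG : 0 ≤ ∫ p in ω, gradSq f p := integral_nonneg fun p => gradSq_nonneg f p
  have hN : 0 ≤ ∫ p in ω, ‖f p‖ ^ 2 := by positivity
  rcases hN.eq_or_lt with h0 | hpos
  · rw [← h0, mul_zero]; exact hG
  · have hne : f ≠ 0 := by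
      rintro rfl
      simp at hpos
    rw [← le_div_iff₀ hpos]
    refine csInf_le ⟨0, ?_⟩ ⟨f, hf, hne, rfl⟩
    rintro r ⟨g, -, -, rfl⟩
    positivity

lemma exists_hasDerivAt_sqrt_normSq_add {u : ℝ → ℂ} {φ : ℝ → ℝ} {u' : ℂ} {φ' x t ε : ℝ}
    (hu : HasDerivAt u u' x) (hφ : HasDerivAt φ φ' x) (ht : 0 < t) (hε : 0 < ε) :
    ∃ d, HasDerivAt (fun y => √(‖u y‖ ^ 2 + t * φ y ^ 2 + ε ^ 2) - ε) d x ∧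
      d ^ 2 ≤ ‖u'‖ ^ 2 + t * φ' ^ 2 ∧
      (φ x = 1 → φ' = 0 → d ^ 2 ≤ ‖u'‖ ^ 2 - t * (‖u'‖ ^ 2 / (‖u x‖ ^ 2 + t))) := by
  set ρ := ‖u x‖ ^ 2 + t * φ x ^ 2 + ε ^ 2 with hρ
  have hρpos : 0 < ρ := by positivity
  have h1 : HasDerivAt (fun y => ‖u y‖ ^ 2 + t * φ y ^ 2 + ε ^ 2)
      (2 * inner ℝ (u x) u' + t * (2 * φ x * φ')) x := by
    have h := (hu.norm_sq.add ((hφ.pow 2).const_mul t)).add_const (ε ^ 2)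
    exact h.congr_deriv (by norm_num)
  refine ⟨_, (h1.sqrt hρpos.ne').sub_const ε, ?_⟩
  rw [← hρ]
  have hin : |inner ℝ (u x) u'| ≤ ‖u x‖ * ‖u'‖ := abs_real_inner_le_norm _ _
  set i := inner ℝ (u x) u' with hi
  have hin2 : i ^ 2 ≤ ‖u x‖ ^ 2 * ‖u'‖ ^ 2 := by
    rw [← mul_pow, ← sq_abs i]
    gcongr
  have hd : ((2 * i + t * (2 * φ x * φ')) / (2 * √ρ)) ^ 2 = (i + t * φ x * φ') ^ 2 / ρ := by
    rw [div_pow, mul_pow, Real.sq_sqrt hρpos.le]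
    field_simp
  rw [hd]
  constructor
  · rw [div_le_iff₀ hρpos]
    have hx : 2 * (i * (φ x * φ')) ≤ ‖u x‖ ^ 2 * φ' ^ 2 + φ x ^ 2 * ‖u'‖ ^ 2 := by
      have := two_mul_le_add_sq (‖u x‖ * |φ'|) (|φ x| * ‖u'‖)
      have h3 : i * (φ x * φ') ≤ (‖u x‖ * ‖u'‖) * (|φ x| * |φ'|) := by
        rw [← abs_mul]
        refine (le_abs_self _).trans ?_
        rw [abs_mul]
        gcongr
      simp only [mul_pow, sq_abs] at this
      nlinarith
    have h4 := mul_le_mul_of_nonneg_left hx ht.le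
    have h5 : 0 ≤ ε ^ 2 * (‖u'‖ ^ 2 + t * φ' ^ 2) := by positivity
    rw [hρ]
    nlinarith
  · intro h1 h2
    have hv : 0 < ‖u x‖ ^ 2 + t := by positivity
    have : ‖u'‖ ^ 2 - t * (‖u'‖ ^ 2 / (‖u x‖ ^ 2 + t)) =
        ‖u x‖ ^ 2 * ‖u'‖ ^ 2 / (‖u x‖ ^ 2 + t) := by
      field_simp
      ring
    rw [this, h2, mul_zero, add_zero]
    refine div_le_div₀ (by positivity) hin2 hv ?_
    rw [hρ, h1]
    nlinarith [sq_nonneg ε]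

/-- The smooth competitor `√(|g|² + t φ² + ε²) - ε`. -/
def competitor (g : ℝ × ℝ → ℂ) (φ : ℝ × ℝ → ℝ) (t ε : ℝ) (p : ℝ × ℝ) : ℂ :=
  ((√(‖g p‖ ^ 2 + t * φ p ^ 2 + ε ^ 2) - ε : ℝ) : ℂ)

lemma isTest2_competitor {ω : Set (ℝ × ℝ)} {g : ℝ × ℝ → ℂ} {φ : ℝ × ℝ → ℝ} {t ε : ℝ}
    (hg : IsTest2 ω g) (hφ : ContDiff ℝ (⊤ : ℕ∞) φ) (hφc : HasCompactSupport φ)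
    (hφω : tsupport φ ⊆ ω) (ht : 0 < t) (hε : 0 < ε) : IsTest2 ω (competitor g φ t ε) := by
  obtain ⟨hg1, hg2, hg3⟩ := hg
  have hsub : tsupport (competitor g φ t ε) ⊆ tsupport g ∪ tsupport φ := by
    apply closure_minimal _ ((isClosed_tsupport g).union (isClosed_tsupport φ))
    intro p hp
    by_contra hn
    simp only [mem_union, not_or] at hn
    apply hp
    simp [competitor, image_eq_zero_of_notMem_tsupport hn.1,
      image_eq_zero_of_notMem_tsupport hn.2, Real.sqrt_sq hε.le]
  refine ⟨?_, ?_, hsub.trans (union_subset hg3 hφω)⟩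
  · have h1 : ContDiff ℝ (⊤ : ℕ∞) fun p => ‖g p‖ ^ 2 + t * φ p ^ 2 + ε ^ 2 :=
      ((hg1.norm_sq ℝ).add (contDiff_const.mul (hφ.pow 2))).add contDiff_const
    exact Complex.ofRealCLM.contDiff.comp
      ((h1.sqrt fun p => by positivity).sub contDiff_const)
  · exact (hg2.isCompact.union hφc.isCompact).of_isClosed_subset (isClosed_tsupport _) hsub

lemma gradSq_competitor_le {g : ℝ × ℝ → ℂ} {φ : ℝ × ℝ → ℝ} {t ε : ℝ}
    (hg : Differentiable ℝ g) (hφ : Differentiable ℝ φ) (ht : 0 < t) (hε : 0 < ε) (p : ℝ × ℝ) :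
    gradSq (competitor g φ t ε) p ≤ gradSq g p +
        t * ((fderiv ℝ φ p (1, 0)) ^ 2 + (fderiv ℝ φ p (0, 1)) ^ 2) ∧
      (φ p = 1 → fderiv ℝ φ p = 0 → gradSq (competitor g φ t ε) p ≤ gradSq g p -
        t * (gradSq g p / (‖g p‖ ^ 2 + t))) := by
  obtain ⟨d, hd, hd1, hd2⟩ := exists_hasDerivAt_sqrt_normSq_add (hasDerivAt_slice_fst (hg p))
    (hasDerivAt_slice_fst (hφ p)) ht hε
  obtain ⟨e, he, he1, he2⟩ := exists_hasDerivAt_sqrt_normSq_add (hasDerivAt_slice_snd (hg p))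
    (hasDerivAt_slice_snd (hφ p)) ht hε
  have h1 : pd1' (competitor g φ t ε) p = d := hd.ofReal_comp.deriv
  have h2 : pd2' (competitor g φ t ε) p = e := he.ofReal_comp.deriv
  simp only [gradSq, h1, h2, pd1'_eq_fderiv (hg p), pd2'_eq_fderiv (hg p), Complex.norm_real,
    Real.norm_eq_abs, sq_abs]
  refine ⟨by linarith, fun hp hp' => ?_⟩
  have h3 := hd2 hp (by simp [hp'])
  have h4 := he2 hp (by simp [hp'])
  simp only [Prod.mk.eta] at h3 h4
  rw [add_div, mul_add]
  linarith

/-- Caccioppoli-type bound for the logarithmic gradient of near-minimizers. -/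
lemma exists_setIntegral_gradSq_div_le {ω S : Set (ℝ × ℝ)}
    (hω_bdd : Bornology.IsBounded ω) (hS : MeasurableSet S) (hSω : S ⊆ ω) {φ : ℝ × ℝ → ℝ}
    (hφ : ContDiff ℝ (⊤ : ℕ∞) φ) (hφc : HasCompactSupport φ) (hφω : tsupport φ ⊆ ω)
    (hφ1 : ∀ p ∈ S, φ p = 1) (hφ' : ∀ p ∈ S, fderiv ℝ φ p = 0) :
    ∃ K : ℝ, ∀ g, IsTest2 ω g → ∀ t > 0,
      (∫ p in ω, gradSq g p) - E1 ω * ∫ p in ω, ‖g p‖ ^ 2 ≤ t →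
      ∫ p in S, gradSq g p / (‖g p‖ ^ 2 + t) ≤ K := by
  set eφ : ℝ × ℝ → ℝ := fun p => (fderiv ℝ φ p (1, 0)) ^ 2 + (fderiv ℝ φ p (0, 1)) ^ 2 with heφ
  have hφcont : Continuous φ := hφ.continuous
  have hφ'c : Continuous (fderiv ℝ φ) := hφ.continuous_fderiv (by simp)
  have heφc : Continuous eφ := by fun_prop
  refine ⟨2 + ∫ p in ω, eφ p, fun g hg t ht hq => ?_⟩
  have hgc : Continuous g := hg.1.continuous
  have hgg : Continuous (gradSq g) := continuous_gradSq hg.1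
  have hInt : ∀ {f : ℝ × ℝ → ℝ}, Continuous f → IntegrableOn f ω := fun hf =>
    integrableOn_of_continuous_of_isBounded hf hω_bdd
  set B : ℝ × ℝ → ℝ := fun p => ‖g p‖ ^ 2 + t * φ p ^ 2 + 2 with hB
  have hBc : Continuous B := by fun_prop
  have hBint : 0 ≤ ∫ p in ω, B p := integral_nonneg fun p => by simp only [hB]; positivity
  have hE := E1_nonneg ω
  obtain ⟨ε, hε, hε1, hεt⟩ : ∃ ε > 0, ε ≤ 1 ∧ 2 * ε * (E1 ω * ∫ p in ω, B p) ≤ t := by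
    set N := E1 ω * ∫ p in ω, B p
    have hN : 0 ≤ N := by positivity
    refine ⟨min 1 (t / (2 * N + 1)), by positivity, min_le_left _ _, ?_⟩
    calc 2 * min 1 (t / (2 * N + 1)) * N ≤ 2 * (t / (2 * N + 1)) * N := by
          gcongr; exact min_le_right _ _
      _ = t * (2 * N / (2 * N + 1)) := by ring
      _ ≤ t * 1 := by
          gcongr
          rw [div_le_one (by positivity)]; linarith
      _ = t := mul_one t
  set w := competitor g φ t ε with hw
  have hwt : IsTest2 ω w := isTest2_competitor hg hφ hφc hφω ht hε
  have hwc : Continuous w := hwt.1.continuous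
  have hwg : Continuous (gradSq w) := continuous_gradSq hwt.1
  have hquot : Continuous fun p => gradSq g p / (‖g p‖ ^ 2 + t) :=
    hgg.div (by fun_prop) fun p => by positivity
  have hlow : ∀ p, ‖g p‖ ^ 2 - 2 * ε * B p ≤ ‖w p‖ ^ 2 := by
    intro p
    set ρ := ‖g p‖ ^ 2 + t * φ p ^ 2 + ε ^ 2 with hρ
    have hρ0 : 0 ≤ ρ := by positivity
    have h1 : ‖w p‖ ^ 2 = (√ρ - ε) ^ 2 := by
      simp only [hw, competitor, Complex.norm_real, Real.norm_eq_abs, sq_abs, hρ]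
    have h2 : √ρ ≤ B p := by
      have : √ρ ≤ ρ + 1 := by nlinarith [Real.sq_sqrt hρ0, sq_nonneg (√ρ - 1)]
      have h3 : ε ^ 2 ≤ 1 := by nlinarith
      simp only [hB]
      linarith
    have h4 : 0 ≤ t * φ p ^ 2 := by positivity
    rw [h1]
    nlinarith [Real.sq_sqrt hρ0, mul_le_mul_of_nonneg_left h2 hε.le]
  have hup : ∀ p, gradSq w p ≤ gradSq g p + t * eφ p -
      S.indicator (fun p => t * (gradSq g p / (‖g p‖ ^ 2 + t))) p := by
    intro p
    obtain ⟨h1, h2⟩ := gradSq_competitor_le (hg.1.differentiable (by simp))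
      (hφ.differentiable (by simp)) ht hε p
    by_cases hp : p ∈ S
    · have h3 := h2 (hφ1 p hp) (hφ' p hp)
      have h4 : 0 ≤ t * eφ p := by simp only [heφ]; positivity
      rw [indicator_of_mem hp]
      linarith
    · rw [indicator_of_notMem hp, sub_zero]
      exact h1
  have i1 : ∫ p in ω, (‖g p‖ ^ 2 - 2 * ε * B p) ≤ ∫ p in ω, ‖w p‖ ^ 2 :=
    integral_mono (hInt (by fun_prop)) (hInt (by fun_prop)) hlow
  have hindi : IntegrableOn
      (S.indicator fun p => t * (gradSq g p / (‖g p‖ ^ 2 + t))) ω :=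
    (hInt (hquot.const_mul t)).indicator hS
  have i2 : ∫ p in ω, gradSq w p ≤ ∫ p in ω, (gradSq g p + t * eφ p -
      S.indicator (fun p => t * (gradSq g p / (‖g p‖ ^ 2 + t))) p) :=
    integral_mono (hInt hwg) ((hInt (hgg.add (heφc.const_mul t))).sub hindi) hup
  rw [integral_sub (hInt (by fun_prop)) (hInt (by fun_prop)), integral_const_mul] at i1
  rw [integral_sub (hInt (by fun_prop)) hindi,
    integral_add (hInt hgg) (hInt (by fun_prop)), integral_const_mul,
    setIntegral_indicator hS, inter_eq_right.2 hSω, integral_const_mul] at i2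
  have i3 := E1_mul_le ω hwt
  have i4 := mul_le_mul_of_nonneg_left i1 hE
  have : t * ∫ p in S, gradSq g p / (‖g p‖ ^ 2 + t) ≤ t * (2 + ∫ p in ω, eφ p) := by
    rw [mul_sub] at i4
    nlinarith
  exact le_of_mul_le_mul_left this ht

lemma sq_setIntegral_le {f : ℝ → ℝ} (hf : Continuous f) {a b : ℝ} (hab : a < b) :
    (∫ r in Ioo a b, f r) ^ 2 ≤ (b - a) * ∫ r in Ioo a b, f r ^ 2 := by
  have hInt : ∀ {u : ℝ → ℝ}, Continuous u → IntegrableOn u (Ioo a b) := fun hu =>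
    integrableOn_of_continuous_of_isBounded hu (Metric.isBounded_Ioo a b)
  have hba : 0 < b - a := sub_pos.2 hab
  set m := (∫ r in Ioo a b, f r) / (b - a) with hm
  have h : 0 ≤ ∫ r in Ioo a b, (f r ^ 2 - (2 * m * f r - m ^ 2)) := by
    refine integral_nonneg fun r => ?_
    have := sq_nonneg (f r - m)
    simp only [Pi.zero_apply]
    linarith
  rw [integral_sub (hInt (by fun_prop)) (hInt (by fun_prop)),
    integral_sub (hInt (by fun_prop)) (hInt (by fun_prop)), integral_const_mul,
    setIntegral_const] at h
  have hv : volume.real (Ioo a b) = b - a := by simp [Measure.real, hba.le]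
  have hI : ∫ r in Ioo a b, f r = m * (b - a) := by rw [hm]; field_simp
  rw [hv, hI, smul_eq_mul] at h
  rw [hI]
  nlinarith

lemma normSq_sub_le_setIntegral {E : Type*} [NormedAddCommGroup E] [NormedSpace ℝ E]
    [CompleteSpace E] {F F' : ℝ → E} (hF : ∀ x, HasDerivAt F (F' x) x) (hF' : Continuous F')
    {a b x y : ℝ} (hx : x ∈ Ioo a b) (hy : y ∈ Ioo a b) :
    ‖F x - F y‖ ^ 2 ≤ (b - a) * ∫ r in Ioo a b, ‖F' r‖ ^ 2 := by
  have h1 : ‖F x - F y‖ ≤ ∫ r in Ioo a b, ‖F' r‖ := by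
    rw [← intervalIntegral.integral_eq_sub_of_hasDerivAt (fun r _ => hF r)
      (hF'.intervalIntegrable y x)]
    refine intervalIntegral.norm_integral_le_integral_norm_uIoc.trans ?_
    refine setIntegral_mono_set (integrableOn_of_continuous_of_isBounded hF'.norm
      (Metric.isBounded_Ioo a b)) (ae_of_all _ fun r => norm_nonneg _) ?_
    refine (LE.le.eventuallyLE (uIoc_subset_uIcc.trans ?_))
    exact ordConnected_Ioo.uIcc_subset hy hx
  exact (pow_le_pow_left₀ (norm_nonneg _) h1 2).trans
    (sq_setIntegral_le hF'.norm (hx.1.trans hx.2))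

lemma lintegral_prod_lintegral_fst {μ ν : Measure ℝ} [SFinite μ] [SFinite ν]
    {D : ℝ × ℝ → ENNReal} (hD : Measurable D) :
    ∫⁻ x, ∫⁻ r, D (r, x.2) ∂μ ∂(μ.prod ν) = μ univ * ∫⁻ x, D x ∂(μ.prod ν) := by
  have hm : Measurable fun y => ∫⁻ r, D (r, y) ∂μ := hD.lintegral_prod_left'
  rw [lintegral_prod (fun x : ℝ × ℝ => ∫⁻ r, D (r, x.2) ∂μ) (hm.comp measurable_snd).aemeasurable]
  dsimp only
  rw [lintegral_const, ← lintegral_prod_symm' D hD, mul_comm]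

lemma lintegral_prod_lintegral_snd {μ ν : Measure ℝ} [SFinite μ] [SFinite ν]
    {D : ℝ × ℝ → ENNReal} (hD : Measurable D) :
    ∫⁻ x, ∫⁻ r, D (x.1, r) ∂ν ∂(μ.prod ν) = ν univ * ∫⁻ x, D x ∂(μ.prod ν) := by
  have hm : Measurable fun y => ∫⁻ r, D (y, r) ∂ν := hD.lintegral_prod_right'
  rw [lintegral_prod (fun x : ℝ × ℝ => ∫⁻ r, D (x.1, r) ∂ν) (hm.comp measurable_fst).aemeasurable]
  simp only [lintegral_const]
  rw [lintegral_mul_const _ hm, ← lintegral_prod D hD.aemeasurable, mul_comm]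

/-- Poincaré inequality on a rectangle, in the form of a bound for the measures of a
sublevel and a superlevel set. -/
lemma exists_measure_mul_measure_mul_sq_le (a b c d : ℝ) :
    ∃ C : ℝ, 0 ≤ C ∧ ∀ G : ℝ × ℝ → ℝ, ContDiff ℝ 1 G → ∀ (A B : Set (ℝ × ℝ)) (α β : ℝ),
      MeasurableSet A → MeasurableSet B → A ⊆ Ioo a b ×ˢ Ioo c d → B ⊆ Ioo a b ×ˢ Ioo c d →
      (∀ x ∈ A, G x ≤ α) → (∀ x ∈ B, β ≤ G x) → α ≤ β →
      volume.real A * volume.real B * (β - α) ^ 2 ≤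
        C * ∫ p in Ioo a b ×ˢ Ioo c d,
          ((fderiv ℝ G p (1, 0)) ^ 2 + (fderiv ℝ G p (0, 1)) ^ 2) := by
  set S := Ioo a b ×ˢ Ioo c d with hS
  set μ := volume.restrict (Ioo a b) with hμ
  set ν := volume.restrict (Ioo c d) with hν
  have hSm : MeasurableSet S := measurableSet_Ioo.prod measurableSet_Ioo
  have hμν : (volume.restrict S : Measure (ℝ × ℝ)) = μ.prod ν := by
    rw [hS, hμ, hν, Measure.prod_restrict]; rfl
  have hSb : Bornology.IsBounded S := (Metric.isBounded_Ioo a b).prod (Metric.isBounded_Ioo c d)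
  set K : ENNReal := volume S * (2 * ENNReal.ofReal (b - a) * μ univ +
    2 * ENNReal.ofReal (d - c) * ν univ) with hK
  have hKtop : K ≠ ⊤ := by
    have h1 : volume S ≠ ⊤ := hSb.measure_lt_top.ne
    finiteness
  refine ⟨K.toReal, ENNReal.toReal_nonneg, fun G hG A B α β hA hB hAS hBS hGA hGB hαβ => ?_⟩
  have hGd : Differentiable ℝ G := hG.differentiable (by simp)
  have hGc : Continuous (fderiv ℝ G) := hG.continuous_fderiv (by simp)
  set D₁ : ℝ × ℝ → ENNReal := fun p => ENNReal.ofReal ((fderiv ℝ G p (1, 0)) ^ 2) with hD₁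
  set D₂ : ℝ × ℝ → ENNReal := fun p => ENNReal.ofReal ((fderiv ℝ G p (0, 1)) ^ 2) with hD₂
  have hD₁m : Measurable D₁ :=
    ENNReal.measurable_ofReal.comp (by fun_prop : Continuous _).measurable
  have hD₂m : Measurable D₂ :=
    ENNReal.measurable_ofReal.comp (by fun_prop : Continuous _).measurable
  set P : ℝ × ℝ → ENNReal := fun x => 2 * ENNReal.ofReal (b - a) * ∫⁻ r, D₁ (r, x.2) ∂μ with hP
  set R : ℝ × ℝ → ENNReal := fun x => 2 * ENNReal.ofReal (d - c) * ∫⁻ r, D₂ (x.1, r) ∂ν with hR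
  have hPm : Measurable P :=
    ((hD₁m.lintegral_prod_left' (μ := μ)).comp measurable_snd).const_mul _
  have hRm : Measurable R :=
    ((hD₂m.lintegral_prod_right' (ν := ν)).comp measurable_fst).const_mul _
  have hpt : ∀ x ∈ A, ∀ y ∈ B, ENNReal.ofReal ((β - α) ^ 2) ≤ P x + R y := by
    intro x hx y hy
    have hxS := hAS hx
    have hyS := hBS hy
    have h1 := normSq_sub_le_setIntegral (F := fun r => G (r, x.2))
      (F' := fun r => fderiv ℝ G (r, x.2) (1, 0))
      (fun r => hasDerivAt_slice_fst (hGd (r, x.2))) (by fun_prop) hxS.1 hyS.1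
    have h2 := normSq_sub_le_setIntegral (F := fun r => G (y.1, r))
      (F' := fun r => fderiv ℝ G (y.1, r) (0, 1))
      (fun r => hasDerivAt_slice_snd (hGd (y.1, r))) (by fun_prop) hxS.2 hyS.2
    simp only [Real.norm_eq_abs, sq_abs] at h1 h2
    have hb1 : 0 ≤ b - a := by linarith [hxS.1.1, hxS.1.2]
    have hb2 : 0 ≤ d - c := by linarith [hxS.2.1, hxS.2.2]
    have e1 : P x = ENNReal.ofReal (2 * ((b - a) *
        ∫ r in Ioo a b, (fderiv ℝ G (r, x.2) (1, 0)) ^ 2)) := by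
      rw [ENNReal.ofReal_mul zero_le_two, ENNReal.ofReal_mul hb1,
        ofReal_integral_eq_lintegral_ofReal (integrableOn_of_continuous_of_isBounded
          (by fun_prop) (Metric.isBounded_Ioo a b)) (ae_of_all _ fun r => sq_nonneg _)]
      simp [hP, hD₁, hμ, mul_assoc]
    have e2 : R y = ENNReal.ofReal (2 * ((d - c) *
        ∫ r in Ioo c d, (fderiv ℝ G (y.1, r) (0, 1)) ^ 2)) := by
      rw [ENNReal.ofReal_mul zero_le_two, ENNReal.ofReal_mul hb2,
        ofReal_integral_eq_lintegral_ofReal (integrableOn_of_continuous_of_isBounded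
          (by fun_prop) (Metric.isBounded_Ioo c d)) (ae_of_all _ fun r => sq_nonneg _)]
      simp [hR, hD₂, hν, mul_assoc]
    rw [e1, e2, ← ENNReal.ofReal_add (by positivity) (by positivity)]
    apply ENNReal.ofReal_le_ofReal
    have h3 : (β - α) ^ 2 ≤ (G y - G x) ^ 2 :=
      pow_le_pow_left₀ (sub_nonneg.2 hαβ) (by linarith [hGA x hx, hGB y hy]) 2
    simp only [Prod.mk.eta] at h1 h2
    nlinarith [sq_nonneg (G x - G (y.1, x.2) - (G (y.1, x.2) - G y))]
  have hmain : volume A * volume B * ENNReal.ofReal ((β - α) ^ 2) ≤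
      K * ∫⁻ p, (D₁ p + D₂ p) ∂(μ.prod ν) := by
    calc volume A * volume B * ENNReal.ofReal ((β - α) ^ 2)
        = ∫⁻ _ in A, ∫⁻ _ in B, ENNReal.ofReal ((β - α) ^ 2) := by
          simp only [setLIntegral_const]; ring
      _ ≤ ∫⁻ x in A, ∫⁻ y in B, (P x + R y) :=
          setLIntegral_mono' hA fun x hx => setLIntegral_mono' hB fun y hy => hpt x hx y hy
      _ ≤ ∫⁻ x in S, ∫⁻ y in S, (P x + R y) :=
          (lintegral_mono_set hAS).trans (lintegral_mono fun x => lintegral_mono_set hBS)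
      _ = volume S * (∫⁻ x in S, P x) + volume S * ∫⁻ y in S, R y := by
          simp only [lintegral_add_left measurable_const, setLIntegral_const]
          rw [lintegral_add_right _ measurable_const, setLIntegral_const,
            lintegral_mul_const _ hPm]
          ring
      _ = volume S * (2 * ENNReal.ofReal (b - a) * (μ univ * ∫⁻ p, D₁ p ∂(μ.prod ν))) +
          volume S * (2 * ENNReal.ofReal (d - c) * (ν univ * ∫⁻ p, D₂ p ∂(μ.prod ν))) := by
          rw [hμν, ← lintegral_prod_lintegral_fst hD₁m, ← lintegral_prod_lintegral_snd hD₂m,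
            lintegral_const_mul, lintegral_const_mul]
          · exact (hD₂m.lintegral_prod_right' (ν := ν)).comp measurable_fst
          · exact (hD₁m.lintegral_prod_left' (μ := μ)).comp measurable_snd
      _ ≤ volume S * (2 * ENNReal.ofReal (b - a) * (μ univ *
            ∫⁻ p, (D₁ p + D₂ p) ∂(μ.prod ν))) +
          volume S * (2 * ENNReal.ofReal (d - c) * (ν univ *
            ∫⁻ p, (D₁ p + D₂ p) ∂(μ.prod ν))) := by
          gcongr with p p
          · exact le_self_add
          · exact le_add_self
      _ = K * ∫⁻ p, (D₁ p + D₂ p) ∂(μ.prod ν) := by rw [hK]; ring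
  have hInt : ∫⁻ p, (D₁ p + D₂ p) ∂(μ.prod ν) = ENNReal.ofReal (∫ p in S,
      ((fderiv ℝ G p (1, 0)) ^ 2 + (fderiv ℝ G p (0, 1)) ^ 2)) := by
    rw [ofReal_integral_eq_lintegral_ofReal (integrableOn_of_continuous_of_isBounded
      (by fun_prop) hSb) (ae_of_all _ fun r => by positivity), hμν]
    refine lintegral_congr fun p => ?_
    rw [ENNReal.ofReal_add (by positivity) (by positivity)]
  rw [hInt] at hmain
  have h := ENNReal.toReal_mono (ENNReal.mul_ne_top hKtop ENNReal.ofReal_ne_top) hmain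
  simp only [ENNReal.toReal_mul] at h
  rwa [ENNReal.toReal_ofReal (by positivity), ENNReal.toReal_ofReal
    (integral_nonneg fun p => by positivity)] at h

lemma exists_hasDerivAt_log_normSq_add {u : ℝ → ℂ} {u' : ℂ} {x t : ℝ} (hu : HasDerivAt u u' x)
    (ht : 0 < t) : ∃ d, HasDerivAt (fun y => Real.log (‖u y‖ ^ 2 + t)) d x ∧
      d ^ 2 ≤ 4 * (‖u'‖ ^ 2 / (‖u x‖ ^ 2 + t)) := by
  have hρ : 0 < ‖u x‖ ^ 2 + t := by positivity
  refine ⟨_, (hu.norm_sq.add_const t).log hρ.ne', ?_⟩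
  have hin2 : inner ℝ (u x) u' ^ 2 ≤ ‖u x‖ ^ 2 * ‖u'‖ ^ 2 := by
    rw [← mul_pow, ← sq_abs]
    gcongr
    exact abs_real_inner_le_norm _ _
  rw [div_pow, ← mul_div_assoc, div_le_div_iff₀ (by positivity) hρ]
  have h1 : 0 ≤ ‖u'‖ ^ 2 * t * (‖u x‖ ^ 2 + t) := by positivity
  nlinarith [mul_le_mul_of_nonneg_right hin2 hρ.le]

lemma exists_measure_mul_measure_mul_log_sq_le (a b c d : ℝ) :
    ∃ C : ℝ, 0 ≤ C ∧ ∀ g : ℝ × ℝ → ℂ, ContDiff ℝ (⊤ : ℕ∞) g → ∀ (A B : Set (ℝ × ℝ)) (t s r : ℝ),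
      MeasurableSet A → MeasurableSet B → A ⊆ Ioo a b ×ˢ Ioo c d → B ⊆ Ioo a b ×ˢ Ioo c d →
      (∀ x ∈ A, ‖g x‖ ^ 2 ≤ s) → (∀ x ∈ B, r ≤ ‖g x‖ ^ 2) → 0 < t → 0 ≤ s → s ≤ r →
      volume.real A * volume.real B * (Real.log (r + t) - Real.log (s + t)) ^ 2 ≤
        C * ∫ p in Ioo a b ×ˢ Ioo c d, gradSq g p / (‖g p‖ ^ 2 + t) := by
  obtain ⟨C, hC, h⟩ := exists_measure_mul_measure_mul_sq_le a b c d
  refine ⟨C * 4, by positivity, fun g hg A B t s r hA hB hAS hBS hgA hgB ht hs hsr => ?_⟩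
  have hG : ContDiff ℝ (⊤ : ℕ∞) fun p => Real.log (‖g p‖ ^ 2 + t) :=
    ((hg.norm_sq ℝ).add contDiff_const).log fun p => by positivity
  have hGc := hG.continuous_fderiv (by simp)
  have hgd : Differentiable ℝ g := hg.differentiable (by simp)
  have hSb : Bornology.IsBounded (Ioo a b ×ˢ Ioo c d) :=
    (Metric.isBounded_Ioo a b).prod (Metric.isBounded_Ioo c d)
  refine (h _ (hG.of_le (by simp)) A B _ _ hA hB hAS hBS
    (fun x hx => Real.log_le_log (by positivity) (by linarith [hgA x hx]))
    (fun x hx => Real.log_le_log (by linarith) (by linarith [hgB x hx]))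
    (Real.log_le_log (by positivity) (by linarith))).trans ?_
  rw [mul_assoc, ← integral_const_mul 4]
  refine mul_le_mul_of_nonneg_left ?_ hC
  have hgc := hg.continuous
  have hcont : Continuous fun p => gradSq g p / (‖g p‖ ^ 2 + t) :=
    (continuous_gradSq hg).div (by fun_prop) fun p => by positivity
  refine integral_mono (integrableOn_of_continuous_of_isBounded (by fun_prop) hSb)
    (integrableOn_of_continuous_of_isBounded (hcont.const_mul 4) hSb) fun p => ?_
  obtain ⟨d₁, hd₁, hd₁'⟩ := exists_hasDerivAt_log_normSq_add (hasDerivAt_slice_fst (hgd p)) ht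
  obtain ⟨d₂, hd₂, hd₂'⟩ := exists_hasDerivAt_log_normSq_add (hasDerivAt_slice_snd (hgd p)) ht
  have hGp := hG.differentiable (by simp) p
  simp only [gradSq, pd1'_eq_fderiv (hgd p), pd2'_eq_fderiv (hgd p)]
  rw [(hasDerivAt_slice_fst hGp).unique hd₁, (hasDerivAt_slice_snd hGp).unique hd₂, add_div,
    mul_add]
  exact add_le_add hd₁' hd₂'

open scoped Topology in
/-- The sequence `|g n|²` tends to zero in measure on `V`. -/
def VanishesInMeasure (g : ℕ → ℝ × ℝ → ℂ) (V : Set (ℝ × ℝ)) : Prop :=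
  ∀ r : ℝ, 0 < r → Tendsto (fun n => volume (V ∩ {x | r ≤ ‖g n x‖ ^ 2})) atTop (𝓝 0)

lemma VanishesInMeasure.mono {g : ℕ → ℝ × ℝ → ℂ} {V W : Set (ℝ × ℝ)}
    (h : VanishesInMeasure g W) (hVW : V ⊆ W) : VanishesInMeasure g V := fun r hr =>
  tendsto_of_tendsto_of_tendsto_of_le_of_le tendsto_const_nhds (h r hr) (fun _ => zero_le)
    fun _ => measure_mono (inter_subset_inter_left _ hVW)

lemma VanishesInMeasure.union {g : ℕ → ℝ × ℝ → ℂ} {V W : Set (ℝ × ℝ)}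
    (hV : VanishesInMeasure g V) (hW : VanishesInMeasure g W) : VanishesInMeasure g (V ∪ W) := by
  intro r hr
  have h := (hV r hr).add (hW r hr)
  rw [add_zero] at h
  refine tendsto_of_tendsto_of_tendsto_of_le_of_le tendsto_const_nhds h (fun _ => zero_le)
    fun n => ?_
  simp only [union_inter_distrib_right]
  exact measure_union_le _ _

lemma VanishesInMeasure.of_isCompact {g : ℕ → ℝ × ℝ → ℂ} {K : Set (ℝ × ℝ)} (hK : IsCompact K)
    (h : ∀ x ∈ K, ∃ ρ > 0, VanishesInMeasure g (Metric.ball x ρ)) : VanishesInMeasure g K := by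
  refine hK.induction_on (fun r _ => by simp) (fun s t hst ht => ht.mono hst)
    (fun s t hs ht => hs.union ht) fun x hx => ?_
  obtain ⟨ρ, hρ, hv⟩ := h x hx
  exact ⟨_, mem_nhdsWithin_of_mem_nhds (Metric.ball_mem_nhds x hρ), hv⟩

lemma VanishesInMeasure.of_isOpen {g : ℕ → ℝ × ℝ → ℂ} {ω : Set (ℝ × ℝ)} (hω : IsOpen ω)
    (hω_bdd : Bornology.IsBounded ω)
    (h : ∀ x ∈ ω, ∃ ρ > 0, VanishesInMeasure g (Metric.ball x ρ)) : VanishesInMeasure g ω := by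
  intro r hr
  rw [ENNReal.tendsto_nhds_zero]
  intro ε hε
  obtain ⟨K, hKω, hK, hKε⟩ := hω.measurableSet.exists_isCompact_sdiff_lt
    (μ := volume) hω_bdd.measure_lt_top.ne (ENNReal.half_pos hε.ne').ne'
  have hv := ENNReal.tendsto_nhds_zero.1
    (VanishesInMeasure.of_isCompact hK (fun x hx => h x (hKω hx)) r hr) (ε / 2)
    (ENNReal.half_pos hε.ne')
  filter_upwards [hv] with n hn
  calc volume (ω ∩ {x | r ≤ ‖g n x‖ ^ 2})
      ≤ volume (K ∩ {x | r ≤ ‖g n x‖ ^ 2} ∪ ω \ K) := by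
        apply measure_mono
        rintro x ⟨hx, hx'⟩
        by_cases hxK : x ∈ K
        · exact Or.inl ⟨hxK, hx'⟩
        · exact Or.inr ⟨hx, hxK⟩
    _ ≤ ε / 2 + ε / 2 := (measure_union_le _ _).trans (add_le_add hn hKε.le)
    _ = ε := ENNReal.add_halves ε

open scoped Topology in
/-- For near-minimizers, vanishing in measure on a non-null part of a small square propagates to
the whole square. -/
lemma VanishesInMeasure.ball {g : ℕ → ℝ × ℝ → ℂ} {t : ℕ → ℝ} {ω D : Set (ℝ × ℝ)}
    (hω_bdd : Bornology.IsBounded ω) (hg : ∀ n, IsTest2 ω (g n)) (ht : ∀ n, 0 < t n)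
    (ht0 : Tendsto t atTop (𝓝 0))
    (hq : ∀ n, (∫ p in ω, gradSq (g n) p) - E1 ω * ∫ p in ω, ‖g n p‖ ^ 2 ≤ t n)
    {x : ℝ × ℝ} {ρ : ℝ} (hρ : 0 < ρ) (hxω : Metric.closedBall x (2 * ρ) ⊆ ω)
    (hD : MeasurableSet D) (hDx : D ⊆ Metric.ball x ρ) (hD0 : volume D ≠ 0)
    (hv : VanishesInMeasure g D) : VanishesInMeasure g (Metric.ball x ρ) := by
  set S := Metric.ball x ρ with hS
  have hSI : S = Ioo (x.1 - ρ) (x.1 + ρ) ×ˢ Ioo (x.2 - ρ) (x.2 + ρ) := by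
    rw [hS, ← Real.ball_eq_Ioo, ← Real.ball_eq_Ioo, ball_prod_same]
  have hSω : S ⊆ ω := (Metric.ball_subset_closedBall.trans
    (Metric.closedBall_subset_closedBall (by linarith))).trans hxω
  let φ : ContDiffBump x := ⟨ρ, 2 * ρ, hρ, by linarith⟩
  obtain ⟨K, hK⟩ := exists_setIntegral_gradSq_div_le (S := S) (φ := φ) hω_bdd
    Metric.isOpen_ball.measurableSet hSω φ.contDiff φ.hasCompactSupport
    (φ.tsupport_eq.subset.trans hxω)
    (fun p hp => φ.one_of_mem_closedBall (Metric.ball_subset_closedBall hp))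
    (fun p hp => by
      have h : (φ : ℝ × ℝ → ℝ) =ᶠ[𝓝 p] fun _ => 1 := by
        filter_upwards [Metric.isOpen_ball.mem_nhds hp] with y hy
        exact φ.one_of_mem_closedBall (Metric.ball_subset_closedBall hy)
      rw [h.fderiv_eq]; simp)
  obtain ⟨C, hC, hlog⟩ := exists_measure_mul_measure_mul_log_sq_le
    (x.1 - ρ) (x.1 + ρ) (x.2 - ρ) (x.2 + ρ)
  rw [← hSI] at hlog
  have hSfin : volume S ≠ ⊤ := Metric.isBounded_ball.measure_lt_top.ne
  have hDfin : volume D ≠ ⊤ := measure_ne_top_of_subset hDx hSfin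
  set v := volume.real D with hvD
  have hv0 : 0 < v := ENNReal.toReal_pos hD0 hDfin
  intro r hr
  have hfin : ∀ n, volume (S ∩ {x | r ≤ ‖g n x‖ ^ 2}) ≠ ⊤ := fun n =>
    measure_ne_top_of_subset inter_subset_left hSfin
  rw [← ENNReal.tendsto_toReal_iff hfin ENNReal.zero_ne_top,
    ENNReal.toReal_zero, Metric.tendsto_atTop']
  intro η hη
  set M := C * max K 0 with hM
  have hM0 : 0 ≤ M := by positivity
  set L := 1 + 2 * M / (v * η) with hL
  have hL1 : 1 ≤ L := by
    have : 0 ≤ 2 * M / (v * η) := by positivity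
    linarith
  set s := r / 2 * Real.exp (-L) with hs
  have hs0 : 0 < s := by positivity
  have hsr : s ≤ r := by
    have : Real.exp (-L) ≤ 1 := Real.exp_le_one_iff.2 (by linarith)
    rw [hs]; nlinarith
  have e1 : ∀ᶠ n in atTop, t n ≤ s := (ht0.eventually (gt_mem_nhds hs0)).mono fun _ h => h.le
  have e2 : ∀ᶠ n in atTop, volume (D ∩ {x | s ≤ ‖g n x‖ ^ 2}) ≤ ENNReal.ofReal (v / 2) :=
    ENNReal.tendsto_nhds_zero.1 (hv s hs0) _ (ENNReal.ofReal_pos.2 (by positivity))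
  obtain ⟨N, hN⟩ := eventually_atTop.1 (e1.and e2)
  refine ⟨N, fun n hn => ?_⟩
  obtain ⟨h1, h2⟩ := hN n hn.le
  have hgc : Continuous (g n) := (hg n).1.continuous
  set A := D ∩ {x | ‖g n x‖ ^ 2 ≤ s} with hA
  set B := S ∩ {x | r ≤ ‖g n x‖ ^ 2} with hB
  have hAm : MeasurableSet A :=
    hD.inter (isClosed_le (by fun_prop) continuous_const).measurableSet
  have hBm : MeasurableSet B := Metric.isOpen_ball.measurableSet.inter
    (isClosed_le continuous_const (by fun_prop)).measurableSet
  have hAv : v / 2 ≤ volume.real A := by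
    have h3 : volume.real (D ∩ {x | s ≤ ‖g n x‖ ^ 2}) ≤ v / 2 :=
      ENNReal.toReal_le_of_le_ofReal (by positivity) h2
    have h4 : v ≤ volume.real A + volume.real (D ∩ {x | s ≤ ‖g n x‖ ^ 2}) := by
      refine le_trans (measureReal_mono ?_ ?_) (measureReal_union_le _ _)
      · intro y hy
        rcases le_total (‖g n y‖ ^ 2) s with h | h
        · exact Or.inl ⟨hy, h⟩
        · exact Or.inr ⟨hy, h⟩
      · exact measure_ne_top_of_subset (union_subset inter_subset_left inter_subset_left) hDfin
    linarith
  have hlogL : L ≤ Real.log (r + t n) - Real.log (s + t n) := by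
    have h3 : Real.log r ≤ Real.log (r + t n) := Real.log_le_log hr (by linarith [ht n])
    have h4 : Real.log (s + t n) ≤ Real.log (r * Real.exp (-L)) :=
      Real.log_le_log (by linarith [ht n]) (by rw [hs] at h1 ⊢; linarith)
    rw [Real.log_mul hr.ne' (Real.exp_pos _).ne', Real.log_exp] at h4
    linarith
  have hmain := hlog (g n) (hg n).1 A B (t n) s r hAm hBm (inter_subset_left.trans hDx)
    inter_subset_left (fun y hy => hy.2) (fun y hy => hy.2) (ht n) hs0.le hsr
  have hKn : C * ∫ p in S, gradSq (g n) p / (‖g n p‖ ^ 2 + t n) ≤ M :=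
    mul_le_mul_of_nonneg_left ((hK (g n) (hg n) (t n) (ht n) (hq n)).trans (le_max_left _ _)) hC
  have hB0 : 0 ≤ volume.real B := measureReal_nonneg
  have h5 : v / 2 * volume.real B * L ≤ M := by
    calc v / 2 * volume.real B * L ≤ volume.real A * volume.real B *
          (Real.log (r + t n) - Real.log (s + t n)) ^ 2 := by
          gcongr
          exact hlogL.trans (le_self_pow₀ (hL1.trans hlogL) two_ne_zero)
      _ ≤ M := hmain.trans hKn
  have h6 : M < v / 2 * η * L := by
    have : v / 2 * η * L = v / 2 * η + M := by rw [hL]; field_simp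
    have : 0 < v / 2 * η := by positivity
    linarith
  have h7 : volume.real B < η := by
    by_contra! hcon
    have : v / 2 * η * L ≤ v / 2 * volume.real B * L := by gcongr
    linarith
  rw [Real.dist_eq, sub_zero, abs_of_nonneg ENNReal.toReal_nonneg]
  exact h7

open scoped Topology in
lemma VanishesInMeasure.of_subset {g : ℕ → ℝ × ℝ → ℂ} {t : ℕ → ℝ} {ω D : Set (ℝ × ℝ)}
    (hω : IsOpen ω) (hω_bdd : Bornology.IsBounded ω) (hω_conn : IsConnected ω)
    (hg : ∀ n, IsTest2 ω (g n)) (ht : ∀ n, 0 < t n) (ht0 : Tendsto t atTop (𝓝 0))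
    (hq : ∀ n, (∫ p in ω, gradSq (g n) p) - E1 ω * ∫ p in ω, ‖g n p‖ ^ 2 ≤ t n)
    (hD : MeasurableSet D) (hDω : D ⊆ ω) (hD0 : volume D ≠ 0)
    (hv : VanishesInMeasure g D) : VanishesInMeasure g ω := by
  have hball : ∀ x ∈ ω, ∃ ρ > 0, Metric.closedBall x (2 * ρ) ⊆ ω := by
    intro x hx
    obtain ⟨ε, hε, h⟩ := Metric.nhds_basis_closedBall.mem_iff.1 (hω.mem_nhds hx)
    exact ⟨ε / 2, by positivity, by rwa [mul_div_cancel₀ _ two_ne_zero]⟩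
  set U := {x | ∃ ρ > 0, VanishesInMeasure g (Metric.ball x ρ)} with hU
  have hUo : IsOpen U := by
    rw [Metric.isOpen_iff]
    rintro x ⟨ρ, hρ, hx⟩
    refine ⟨ρ, hρ, fun y hy => ⟨ρ - dist y x, sub_pos.2 hy, hx.mono ?_⟩⟩
    exact Metric.ball_subset_ball' (by linarith)
  refine VanishesInMeasure.of_isOpen hω hω_bdd fun x hx => ?_
  refine hω_conn.isPreconnected.subset_of_closure_inter_subset hUo ?_ ?_ hx
  · obtain ⟨x, hxD, hx⟩ := exists_mem_forall_mem_nhdsWithin_pos_measure hD0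
    obtain ⟨ρ, hρ, hxρ⟩ := hball x (hDω hxD)
    refine ⟨x, hDω hxD, ρ, hρ, ?_⟩
    refine VanishesInMeasure.ball hω_bdd hg ht ht0 hq hρ hxρ
      (hD.inter Metric.isOpen_ball.measurableSet) inter_subset_right ?_ (hv.mono inter_subset_left)
    exact (hx _ (inter_mem_nhdsWithin D (Metric.ball_mem_nhds x hρ))).ne'
  · rintro x ⟨hxU, hxω⟩
    obtain ⟨ρ, hρ, hxρ⟩ := hball x hxω
    obtain ⟨y, hy, ⟨ρ', hρ', hyU⟩⟩ := mem_closure_iff_nhds.1 hxU _ (Metric.ball_mem_nhds x hρ)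
    refine ⟨ρ, hρ, ?_⟩
    have ho : IsOpen (Metric.ball y ρ' ∩ Metric.ball x ρ) :=
      Metric.isOpen_ball.inter Metric.isOpen_ball
    exact VanishesInMeasure.ball hω_bdd hg ht ht0 hq hρ hxρ ho.measurableSet inter_subset_right
      (ho.measure_pos volume ⟨y, Metric.mem_ball_self hρ', hy⟩).ne' (hyU.mono inter_subset_left)

lemma norm_fderiv_le_abs_add_abs {u : ℝ × ℝ → ℝ} (p : ℝ × ℝ) :
    ‖fderiv ℝ u p‖ ≤ |fderiv ℝ u p (1, 0)| + |fderiv ℝ u p (0, 1)| := by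
  refine ContinuousLinearMap.opNorm_le_bound _ (by positivity) fun v => ?_
  have hv : v = v.1 • ((1, 0) : ℝ × ℝ) + v.2 • ((0, 1) : ℝ × ℝ) := by ext <;> simp
  have h1 : |v.1| ≤ ‖v‖ := norm_fst_le v
  have h2 : |v.2| ≤ ‖v‖ := norm_snd_le v
  calc ‖fderiv ℝ u p v‖ = |v.1 * fderiv ℝ u p (1, 0) + v.2 * fderiv ℝ u p (0, 1)| := by
        conv_lhs => rw [hv, map_add, map_smul, map_smul]
        rfl
    _ ≤ |v.1| * |fderiv ℝ u p (1, 0)| + |v.2| * |fderiv ℝ u p (0, 1)| := by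
        rw [← abs_mul, ← abs_mul]; exact abs_add_le _ _
    _ ≤ ‖v‖ * |fderiv ℝ u p (1, 0)| + ‖v‖ * |fderiv ℝ u p (0, 1)| := by gcongr
    _ = _ := by ring

/-- A form of Ladyzhenskaya's inequality. -/
lemma exists_setIntegral_norm_pow_four_le {ω : Set (ℝ × ℝ)} (hω_bdd : Bornology.IsBounded ω) :
    ∃ C : ℝ, 0 ≤ C ∧ ∀ g, IsTest2 ω g → ∫ p in ω, ‖g p‖ ^ 4 ≤
      C * (2 * (∫ p in ω, ‖g p‖ ^ 2) + ∫ p in ω, gradSq g p) ^ 2 := by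
  refine ⟨lintegralPowLePowLIntegralFDerivConst (volume : Measure (ℝ × ℝ)) 2, NNReal.coe_nonneg _,
    fun g hg => ?_⟩
  have hgc := hg.1.continuous
  have hgd : Differentiable ℝ g := hg.1.differentiable (by simp)
  have hgg := continuous_gradSq hg.1
  set u : ℝ × ℝ → ℝ := fun p => ‖g p‖ ^ 2 with hu
  have hus : ContDiff ℝ (⊤ : ℕ∞) u := hg.1.norm_sq ℝ
  have huc : HasCompactSupport u := hg.2.1.comp_left (g := fun z : ℂ => ‖z‖ ^ 2) (by simp)
  have huω : tsupport u ⊆ ω := by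
    refine (closure_mono ?_).trans hg.2.2
    intro p hp hp'
    exact hp (by simp [hu, hp'])
  have hfd : Module.finrank ℝ (ℝ × ℝ) = 2 := by simp
  have hconj : ((Module.finrank ℝ (ℝ × ℝ) : ℕ) : ℝ).HolderConjugate 2 := by
    rw [hfd]; exact_mod_cast Real.HolderConjugate.two_two
  have hsob := lintegral_pow_le_pow_lintegral_fderiv (volume : Measure (ℝ × ℝ))
    (hus.of_le (by simp)) huc hconj
  have hpt : ∀ p, ‖fderiv ℝ u p‖ ≤ 2 * ‖g p‖ ^ 2 + gradSq g p := by
    intro p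
    have hup := hus.differentiable (by simp) p
    have e1 := (hasDerivAt_slice_fst hup).unique (hasDerivAt_slice_fst (hgd p)).norm_sq
    have e2 := (hasDerivAt_slice_snd hup).unique (hasDerivAt_slice_snd (hgd p)).norm_sq
    simp only [Prod.mk.eta] at e1 e2
    refine (norm_fderiv_le_abs_add_abs p).trans ?_
    rw [e1, e2, gradSq, pd1'_eq_fderiv (hgd p), pd2'_eq_fderiv (hgd p), abs_mul, abs_mul, abs_two]
    have h1 := abs_real_inner_le_norm (g p) (fderiv ℝ g p (1, 0))
    have h2 := abs_real_inner_le_norm (g p) (fderiv ℝ g p (0, 1))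
    nlinarith [sq_nonneg (‖g p‖ - ‖fderiv ℝ g p (1, 0)‖),
      sq_nonneg (‖g p‖ - ‖fderiv ℝ g p (0, 1)‖)]
  have hL : ENNReal.ofReal (∫ p in ω, ‖g p‖ ^ 4) ≤ ∫⁻ p, ‖u p‖ₑ ^ (2 : ℝ) := by
    rw [ofReal_integral_eq_lintegral_ofReal (integrableOn_of_continuous_of_isBounded
      (by fun_prop) hω_bdd) (ae_of_all _ fun p => by positivity)]
    refine (setLIntegral_le_lintegral _ _).trans (lintegral_mono fun p => le_of_eq ?_)
    have hup : 0 ≤ u p := by simp only [hu]; positivity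
    rw [Real.enorm_of_nonneg hup, ENNReal.rpow_two, ← ENNReal.ofReal_pow hup]
    simp only [hu]
    ring_nf
  have hR : ∫⁻ p, ‖fderiv ℝ u p‖ₑ ≤
      ENNReal.ofReal (2 * (∫ p in ω, ‖g p‖ ^ 2) + ∫ p in ω, gradSq g p) := by
    have hsupp : Function.support (fun p => ‖fderiv ℝ u p‖ₑ) ⊆ ω := by
      refine Subset.trans ?_ huω
      refine Subset.trans ?_ (support_fderiv_subset ℝ)
      intro p hp hp'
      exact hp (show ‖fderiv ℝ u p‖ₑ = 0 by rw [← ofReal_norm, hp', norm_zero, ENNReal.ofReal_zero])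
    rw [← setLIntegral_eq_of_support_subset hsupp, ← integral_const_mul, ← integral_add
      (integrableOn_of_continuous_of_isBounded (by fun_prop) hω_bdd)
      (integrableOn_of_continuous_of_isBounded hgg hω_bdd),
      ofReal_integral_eq_lintegral_ofReal (integrableOn_of_continuous_of_isBounded
        (by fun_prop) hω_bdd) (ae_of_all _ fun p => by
          have := gradSq_nonneg g p
          simp only [Pi.zero_apply]; positivity)]
    refine lintegral_mono fun p => ?_
    rw [← ofReal_norm]
    exact ENNReal.ofReal_le_ofReal (hpt p)
  have hR0 : 0 ≤ 2 * (∫ p in ω, ‖g p‖ ^ 2) + ∫ p in ω, gradSq g p :=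
    add_nonneg (by positivity) (integral_nonneg fun p => gradSq_nonneg g p)
  have h := (hL.trans hsob).trans (mul_le_mul_right (ENNReal.rpow_le_rpow hR zero_le_two) _)
  rw [ENNReal.rpow_two, ← ENNReal.ofReal_pow hR0, ← ENNReal.ofReal_coe_nnreal,
    ← ENNReal.ofReal_mul (NNReal.coe_nonneg _)] at h
  exact (ENNReal.ofReal_le_ofReal_iff (by positivity)).1 h

lemma not_vanishesInMeasure {ω : Set (ℝ × ℝ)} (hω : IsOpen ω) (hω_bdd : Bornology.IsBounded ω)
    {g : ℕ → ℝ × ℝ → ℂ} (hg : ∀ n, IsTest2 ω (g n)) (hg1 : ∀ n, ∫ p in ω, ‖g n p‖ ^ 2 = 1)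
    {M : ℝ} (hM : ∀ n, ∫ p in ω, gradSq (g n) p ≤ M) : ¬ VanishesInMeasure g ω := by
  intro hv
  obtain ⟨C, hC, hC4⟩ := exists_setIntegral_norm_pow_four_le hω_bdd
  have hM0 : 0 ≤ M := (integral_nonneg fun p => gradSq_nonneg (g 0) p).trans (hM 0)
  set N := C * (2 + M) ^ 2 with hN
  have hN0 : 0 ≤ N := by positivity
  have hN4 : ∀ n, ∫ p in ω, ‖g n p‖ ^ 4 ≤ N := by
    intro n
    refine (hC4 _ (hg n)).trans ?_
    have h0 : 0 ≤ ∫ p in ω, gradSq (g n) p := integral_nonneg fun p => gradSq_nonneg (g n) p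
    rw [hg1, hN, mul_one]
    gcongr
    exact hM n
  have hωfin : volume ω ≠ ⊤ := hω_bdd.measure_lt_top.ne
  set V := volume.real ω with hV
  have hV0 : 0 ≤ V := measureReal_nonneg
  set r := 1 / (4 * (V + 1)) with hr
  set κ := 1 / (4 * (N + 1)) with hκ
  have hr0 : 0 < r := by positivity
  have hκ0 : 0 < κ := by positivity
  obtain ⟨n, hn⟩ := (ENNReal.tendsto_nhds_zero.1 (hv r hr0) (ENNReal.ofReal κ)
    (ENNReal.ofReal_pos.2 hκ0)).exists
  set P := ω ∩ {x | r ≤ ‖g n x‖ ^ 2} with hP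
  have hgc := (hg n).1.continuous
  have hPm : MeasurableSet P := hω.measurableSet.inter
    (isClosed_le continuous_const (by fun_prop)).measurableSet
  have hPv : volume.real P ≤ κ := ENNReal.toReal_le_of_le_ofReal hκ0.le hn
  have hInt : ∀ {f : ℝ × ℝ → ℝ}, Continuous f → IntegrableOn f ω := fun hf =>
    integrableOn_of_continuous_of_isBounded hf hω_bdd
  have hindi : IntegrableOn (P.indicator fun _ => 1 / (4 * κ)) ω :=
    (hInt continuous_const).indicator hPm
  have hle : ∫ p in ω, ‖g n p‖ ^ 2 ≤
      ∫ p in ω, ((r + κ * ‖g n p‖ ^ 4) + P.indicator (fun _ => 1 / (4 * κ)) p) := by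
    refine setIntegral_mono_on (hInt (by fun_prop)) ((hInt (by fun_prop)).add hindi)
      hω.measurableSet fun p hp => ?_
    by_cases hpP : p ∈ P
    · rw [indicator_of_mem hpP]
      have h4 : ‖g n p‖ ^ 2 ≤ κ * ‖g n p‖ ^ 4 + 1 / (4 * κ) := by
        rw [← sub_nonneg]
        have : κ * ‖g n p‖ ^ 4 + 1 / (4 * κ) - ‖g n p‖ ^ 2 =
            κ * (‖g n p‖ ^ 2 - 1 / (2 * κ)) ^ 2 := by
          field_simp
          ring
        rw [this]
        positivity
      linarith
    · rw [indicator_of_notMem hpP]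
      have h1 : ‖g n p‖ ^ 2 ≤ r := by
        by_contra! hcon
        exact hpP ⟨hp, hcon.le⟩
      have h2 : 0 ≤ κ * ‖g n p‖ ^ 4 := by positivity
      linarith
  rw [hg1, integral_add (hInt (by fun_prop)) hindi,
    integral_add (hInt continuous_const) (hInt (by fun_prop)), integral_const_mul,
    setIntegral_indicator hPm, inter_eq_right.2 inter_subset_left, setIntegral_const,
    setIntegral_const, smul_eq_mul, smul_eq_mul] at hle
  have h1 : V * r ≤ 1 / 4 := by
    rw [hr, mul_one_div, div_le_div_iff₀ (by positivity) (by positivity)]; linarith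
  have h2 : κ * ∫ p in ω, ‖g n p‖ ^ 4 ≤ 1 / 4 := by
    refine (mul_le_mul_of_nonneg_left (hN4 n) hκ0.le).trans ?_
    rw [hκ, one_div_mul_eq_div, div_le_div_iff₀ (by positivity) (by positivity)]; linarith
  have h3 : volume.real P * (1 / (4 * κ)) ≤ 1 / 4 := by
    rw [mul_one_div, div_le_div_iff₀ (by positivity) (by positivity)]; linarith
  linarith

lemma gradSq_const_smul (c : ℝ) (f : ℝ × ℝ → ℂ) (p : ℝ × ℝ) :
    gradSq (c • f) p = c ^ 2 * gradSq f p := by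
  have h1 : pd1' (c • f) p = c • pd1' f p := deriv_const_smul_field c (fun t => f (t, p.2))
  have h2 : pd2' (c • f) p = c • pd2' f p := deriv_const_smul_field c (fun t => f (p.1, t))
  simp only [gradSq, h1, h2, norm_smul, mul_pow, Real.norm_eq_abs, sq_abs]
  ring

lemma IsTest2.const_smul {ω : Set (ℝ × ℝ)} {f : ℝ × ℝ → ℂ} (hf : IsTest2 ω f) (c : ℝ) :
    IsTest2 ω (c • f) :=
  ⟨hf.1.const_smul c, hf.2.1.smul_left (f := fun _ => c),
    (tsupport_smul_subset_right (fun _ => c) f).trans hf.2.2⟩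

open scoped Topology in
/-- Adding the indicator of a non-null set to the Dirichlet Laplacian on a connected bounded open
set strictly raises the lowest eigenvalue. -/
lemma exists_mul_setIntegral_le {ω D : Set (ℝ × ℝ)} (hω : IsOpen ω)
    (hω_bdd : Bornology.IsBounded ω) (hω_conn : IsConnected ω) (hD : MeasurableSet D)
    (hDω : D ⊆ ω) (hD0 : volume D ≠ 0) :
    ∃ δ > 0, ∀ g, IsTest2 ω g → δ * ∫ p in ω, ‖g p‖ ^ 2 ≤
      ((∫ p in ω, gradSq g p) - E1 ω * ∫ p in ω, ‖g p‖ ^ 2) + ∫ p in D, ‖g p‖ ^ 2 := by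
  by_contra! hcon
  have hpos : ∀ n : ℕ, (0 : ℝ) < 1 / (n + 1) := fun n => by positivity
  choose f hf hfn using fun n : ℕ => hcon (1 / (n + 1)) (hpos n)
  have hNpos : ∀ n, 0 < ∫ p in ω, ‖f n p‖ ^ 2 := by
    intro n
    have h1 := E1_mul_le ω (hf n)
    have h2 : 0 ≤ ∫ p in D, ‖f n p‖ ^ 2 := by positivity
    have h3 : 0 < 1 / ((n : ℝ) + 1) * ∫ p in ω, ‖f n p‖ ^ 2 := by linarith [hfn n]
    exact pos_of_mul_pos_right h3 (hpos n).le
  set c : ℕ → ℝ := fun n => (√(∫ p in ω, ‖f n p‖ ^ 2))⁻¹ with hc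
  have hc2 : ∀ n, c n ^ 2 * ∫ p in ω, ‖f n p‖ ^ 2 = 1 := fun n => by
    simp only [hc, inv_pow, Real.sq_sqrt (hNpos n).le]
    exact inv_mul_cancel₀ (hNpos n).ne'
  set g : ℕ → ℝ × ℝ → ℂ := fun n => c n • f n with hgdef
  have hg : ∀ n, IsTest2 ω (g n) := fun n => (hf n).const_smul _
  have hnorm : ∀ n (s : Set (ℝ × ℝ)), ∫ p in s, ‖g n p‖ ^ 2 = c n ^ 2 * ∫ p in s, ‖f n p‖ ^ 2 := by
    intro n s
    rw [← integral_const_mul]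
    refine integral_congr_ae (ae_of_all _ fun p => ?_)
    simp [hgdef, mul_pow]
  have hgrad : ∀ n, ∫ p in ω, gradSq (g n) p = c n ^ 2 * ∫ p in ω, gradSq (f n) p := by
    intro n
    rw [← integral_const_mul]
    exact integral_congr_ae (ae_of_all _ fun p => gradSq_const_smul _ _ p)
  have hg1 : ∀ n, ∫ p in ω, ‖g n p‖ ^ 2 = 1 := fun n => (hnorm n ω).trans (hc2 n)
  have hle : ∀ n, ((∫ p in ω, gradSq (g n) p) - E1 ω * ∫ p in ω, ‖g n p‖ ^ 2) +
      ∫ p in D, ‖g n p‖ ^ 2 ≤ 1 / ((n : ℝ) + 1) := by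
    intro n
    have := mul_le_mul_of_nonneg_left (hfn n).le (sq_nonneg (c n))
    rw [hnorm, hnorm, hgrad]
    calc _ = c n ^ 2 * (((∫ p in ω, gradSq (f n) p) - E1 ω * ∫ p in ω, ‖f n p‖ ^ 2) +
          ∫ p in D, ‖f n p‖ ^ 2) := by ring
      _ ≤ _ := this
      _ = 1 / ((n : ℝ) + 1) * (c n ^ 2 * ∫ p in ω, ‖f n p‖ ^ 2) := by ring
      _ = _ := by rw [hc2, mul_one]
  have hDn : ∀ n, ∫ p in D, ‖g n p‖ ^ 2 ≤ 1 / ((n : ℝ) + 1) := fun n => by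
    linarith [hle n, E1_mul_le ω (hg n)]
  have hqn : ∀ n, (∫ p in ω, gradSq (g n) p) - E1 ω * ∫ p in ω, ‖g n p‖ ^ 2 ≤
      1 / ((n : ℝ) + 1) := fun n => by
    have : 0 ≤ ∫ p in D, ‖g n p‖ ^ 2 := by positivity
    linarith [hle n]
  have ht0 : Tendsto (fun n : ℕ => 1 / ((n : ℝ) + 1)) atTop (𝓝 0) :=
    tendsto_one_div_add_atTop_nhds_zero_nat
  have hvD : VanishesInMeasure g D := by
    intro r hr
    have hfin : ∀ n, volume (D ∩ {x | r ≤ ‖g n x‖ ^ 2}) ≠ ⊤ := fun n =>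
      measure_ne_top_of_subset (inter_subset_left.trans hDω) hω_bdd.measure_lt_top.ne
    rw [← ENNReal.tendsto_toReal_iff hfin ENNReal.zero_ne_top, ENNReal.toReal_zero]
    have hlim : Tendsto (fun n : ℕ => r⁻¹ * (1 / ((n : ℝ) + 1))) atTop (𝓝 0) := by
      simpa using ht0.const_mul r⁻¹
    refine squeeze_zero (fun n => ENNReal.toReal_nonneg) (fun n => ?_) hlim
    have hgc := (hg n).1.continuous
    have h := mul_meas_ge_le_integral_of_nonneg (μ := volume.restrict D)
      (f := fun p => ‖g n p‖ ^ 2) (ae_of_all _ fun p => by positivity)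
      (integrableOn_of_continuous_of_isBounded (by fun_prop) (hω_bdd.subset hDω)) r
    rw [measureReal_restrict_apply
      (isClosed_le continuous_const (by fun_prop)).measurableSet, inter_comm] at h
    rw [le_inv_mul_iff₀ hr]
    exact h.trans (hDn n)
  refine not_vanishesInMeasure hω hω_bdd hg hg1 (M := E1 ω + 1) (fun n => ?_)
    (hvD.of_subset hω hω_bdd hω_conn hg hpos ht0 hqn hD hDω hD0)
  have h1 := hqn n
  have h2 : 1 / ((n : ℝ) + 1) ≤ 1 := by
    rw [div_le_one (by positivity)]
    linarith [(Nat.cast_nonneg n : (0 : ℝ) ≤ n)]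
  rw [hg1] at h1
  linarith

lemma rot_rot (α β : ℝ) (p : ℝ × ℝ) : rot α (rot β p) = rot (α + β) p := by
  simp only [rot, Real.cos_add, Real.sin_add]
  ext <;> simp only <;> ring

lemma rot_zero (p : ℝ × ℝ) : rot 0 p = p := by
  simp [rot]

lemma continuous_rot : Continuous fun q : ℝ × ℝ × ℝ => rot q.1 q.2 := by
  unfold rot
  fun_prop

lemma continuous_rot_right (ϑ : ℝ) : Continuous (rot ϑ) :=
  continuous_rot.comp (Continuous.prodMk_right ϑ)

lemma measurableEmbedding_rot (ϑ : ℝ) : MeasurableEmbedding (rot ϑ) :=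
  (Homeomorph.mk ⟨rot ϑ, rot (-ϑ), fun p => by rw [rot_rot, neg_add_cancel, rot_zero],
    fun p => by rw [rot_rot, add_neg_cancel, rot_zero]⟩ (continuous_rot_right ϑ)
      (continuous_rot_right (-ϑ))).measurableEmbedding

lemma measurePreserving_rot (ϑ : ℝ) : MeasurePreserving (rot ϑ) volume volume := by
  refine ⟨(continuous_rot_right ϑ).measurable, ?_⟩
  set L : ℝ × ℝ →ₗ[ℝ] ℝ × ℝ :=
    Matrix.toLin (Module.Basis.finTwoProd ℝ) (Module.Basis.finTwoProd ℝ)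
      !![Real.cos ϑ, Real.sin ϑ; -Real.sin ϑ, Real.cos ϑ] with hL
  have hrot : rot ϑ = L := by
    ext p <;> simp [hL, rot, Matrix.toLin_finTwoProd_apply] <;> ring
  have hdet : LinearMap.det L = 1 := by
    rw [hL, LinearMap.det_toLin, Matrix.det_fin_two_of]
    nlinarith [Real.sin_sq_add_cos_sq ϑ]
  rw [hrot, Measure.map_linearMap_addHaar_eq_smul_addHaar _ (by rw [hdet]; exact one_ne_zero), hdet]
  simp

lemma rot_image_eq_preimage (ϑ : ℝ) (s : Set (ℝ × ℝ)) : rot ϑ '' s = rot (-ϑ) ⁻¹' s :=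
  congrFun (image_eq_preimage_of_inverse (f := rot ϑ) (g := rot (-ϑ))
    (fun p => by rw [rot_rot, neg_add_cancel, rot_zero])
    fun p => by rw [rot_rot, add_neg_cancel, rot_zero]) s

lemma rot_nsmul_preimage_ae_eq {ω : Set (ℝ × ℝ)} {α : ℝ} (h : rot α ⁻¹' ω =ᵐ[volume] ω) (n : ℕ) :
    rot (n • α) ⁻¹' ω =ᵐ[volume] ω := by
  induction n with
  | zero =>
    have : rot (0 • α) = id := by
      rw [zero_nsmul]
      exact funext rot_zero
    rw [this, preimage_id]
    exact EventuallyEq.rfl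
  | succ n ih =>
    have : rot ((n + 1) • α) = rot (n • α) ∘ rot α :=
      funext fun p => by rw [Function.comp, rot_rot, add_nsmul, one_nsmul]
    rw [this, preimage_comp]
    exact ((measurePreserving_rot α).quasiMeasurePreserving.preimage_ae_eq ih).trans h

/-- If `θ` is not constant on an interval and `ω` is not rotationally symmetric, then two of the
copies of `ω` rotated by the values of `θ` differ by a non-null set. -/
lemma exists_volume_rot_preimage_diff_ne_zero {ω : Set (ℝ × ℝ)} {θ : ℝ → ℝ} (hθ : Continuous θ)
    {a b : ℝ} (hθI : ∃ s ∈ Ioo a b, ∃ t ∈ Ioo a b, θ s ≠ θ t)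
    (hrot : ∃ ϑ ∈ Ioo (0 : ℝ) (2 * Real.pi), volume (symmDiff (rot ϑ '' ω) ω) ≠ 0) :
    ∃ s ∈ Ioo a b, ∃ t ∈ Ioo a b, volume ((rot (-θ s) ⁻¹' ω) \ (rot (-θ t) ⁻¹' ω)) ≠ 0 := by
  by_contra! hcon
  have hae : ∀ s ∈ Ioo a b, ∀ t ∈ Ioo a b, rot (θ t - θ s) ⁻¹' ω =ᵐ[volume] ω := by
    intro s hs t ht
    have h : rot (-θ s) ⁻¹' ω =ᵐ[volume] rot (-θ t) ⁻¹' ω :=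
      ae_eq_set.2 ⟨hcon s hs t ht, hcon t ht s hs⟩
    have h' := (measurePreserving_rot (θ t)).quasiMeasurePreserving.preimage_ae_eq h
    rw [← preimage_comp, ← preimage_comp] at h'
    have h1 : rot (-θ s) ∘ rot (θ t) = rot (θ t - θ s) :=
      funext fun p => by rw [Function.comp, rot_rot, neg_add_eq_sub]
    have h2 : rot (-θ t) ∘ rot (θ t) = id :=
      funext fun p => by rw [Function.comp, rot_rot, neg_add_cancel, rot_zero, id]
    rwa [h1, h2, preimage_id] at h'
  obtain ⟨ϑ, ⟨hϑ0, -⟩, hϑ⟩ := hrot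
  have hlt : ∃ s ∈ Ioo a b, ∃ t ∈ Ioo a b, θ s < θ t := by
    obtain ⟨s, hs, t, ht, hst⟩ := hθI
    rcases hst.lt_or_gt with h | h
    exacts [⟨s, hs, t, ht, h⟩, ⟨t, ht, s, hs, h⟩]
  obtain ⟨s, hs, t, ht, hst⟩ := hlt
  obtain ⟨n, hn⟩ := exists_nat_gt (ϑ / (θ t - θ s))
  have hst' : 0 < θ t - θ s := sub_pos.2 hst
  have hn0 : (0 : ℝ) < n := (div_pos hϑ0 hst').trans hn
  rw [div_lt_iff₀ hst'] at hn
  have hmem : θ t - ϑ / n ∈ Icc (θ s) (θ t) := by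
    have h1 : ϑ / n ≤ θ t - θ s := by
      rw [div_le_iff₀ hn0]
      linarith
    have h2 : 0 ≤ ϑ / n := by positivity
    constructor <;> linarith
  obtain ⟨r, hr, hr'⟩ := isPreconnected_Ioo.intermediate_value hs ht hθ.continuousOn hmem
  have h := hae t ht r hr
  rw [hr'] at h
  have h' := rot_nsmul_preimage_ae_eq h n
  refine hϑ (measure_symmDiff_eq_zero_iff.2 ?_)
  have hnϑ : n • (θ t - ϑ / n - θ t) = -ϑ := by
    rw [nsmul_eq_mul]
    field_simp
    ring
  rwa [rot_image_eq_preimage, ← hnϑ]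

open scoped Topology in
lemma eventually_volume_rot_preimage_diff_ne_zero {ω : Set (ℝ × ℝ)} (hω : IsOpen ω) {θ : ℝ → ℝ}
    (hθ : Continuous θ) {s t : ℝ} (h : volume ((rot (-θ s) ⁻¹' ω) \ (rot (-θ t) ⁻¹' ω)) ≠ 0) :
    ∀ᶠ r in 𝓝 s, volume ((rot (-θ r) ⁻¹' ω) \ (rot (-θ t) ⁻¹' ω)) ≠ 0 := by
  have hms : MeasurableSet ((rot (-θ s) ⁻¹' ω) \ (rot (-θ t) ⁻¹' ω)) :=
    (hω.preimage (continuous_rot_right _)).measurableSet.diff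
      (hω.preimage (continuous_rot_right _)).measurableSet
  obtain ⟨K, hK, hKc, hK0⟩ := hms.exists_lt_isCompact (pos_iff_ne_zero.2 h)
  have hc : Continuous fun q : ℝ × ℝ × ℝ => rot (-θ q.1) q.2 :=
    continuous_rot.comp (f := fun q : ℝ × ℝ × ℝ => (-θ q.1, q.2)) (by fun_prop)
  have hev : ∀ᶠ r in 𝓝 s, ∀ p ∈ K, (r, p) ∈ (fun q : ℝ × ℝ × ℝ => rot (-θ q.1) q.2) ⁻¹' ω :=
    hKc.eventually_forall_of_forall_eventually fun p hp =>
      (hω.preimage hc).mem_nhds (hK hp).1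
  filter_upwards [hev] with r hr
  have hsub : K ⊆ (rot (-θ r) ⁻¹' ω) \ (rot (-θ t) ⁻¹' ω) := fun p hp => ⟨hr p hp, (hK hp).2⟩
  exact (hK0.trans_le (measure_mono hsub)).ne'

/-- The longitudinal derivative `∂₁ψ − θ̇ ∂_τψ` in the twisted frame. -/
def twistedDeriv (θ : ℝ → ℝ) (ψ : ℝ × ℝ × ℝ → ℂ) (x : ℝ × ℝ × ℝ) : ℂ :=
  pd1 ψ x - deriv θ x.1 • pdtau ψ x

lemma pd1_eq_fderiv {ψ : ℝ × ℝ × ℝ → ℂ} {x : ℝ × ℝ × ℝ} (h : DifferentiableAt ℝ ψ x) :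
    pd1 ψ x = fderiv ℝ ψ x (1, 0, 0) :=
  (HasFDerivAt.comp_hasDerivAt (f := fun t => (t, x.2.1, x.2.2)) x.1 h.hasFDerivAt
    ((hasDerivAt_id _).prodMk (hasDerivAt_const _ _))).deriv

lemma pd2_eq_fderiv {ψ : ℝ × ℝ × ℝ → ℂ} {x : ℝ × ℝ × ℝ} (h : DifferentiableAt ℝ ψ x) :
    pd2 ψ x = fderiv ℝ ψ x (0, 1, 0) :=
  (HasFDerivAt.comp_hasDerivAt (f := fun t => (x.1, t, x.2.2)) x.2.1 h.hasFDerivAt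
    ((hasDerivAt_const _ _).prodMk ((hasDerivAt_id _).prodMk (hasDerivAt_const _ _)))).deriv

lemma pd3_eq_fderiv {ψ : ℝ × ℝ × ℝ → ℂ} {x : ℝ × ℝ × ℝ} (h : DifferentiableAt ℝ ψ x) :
    pd3 ψ x = fderiv ℝ ψ x (0, 0, 1) :=
  (HasFDerivAt.comp_hasDerivAt (f := fun t => (x.1, x.2.1, t)) x.2.2 h.hasFDerivAt
    ((hasDerivAt_const _ _).prodMk ((hasDerivAt_const _ _).prodMk (hasDerivAt_id _)))).deriv

lemma twistedDeriv_eq_fderiv {θ : ℝ → ℝ} {ψ : ℝ × ℝ × ℝ → ℂ} {x : ℝ × ℝ × ℝ}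
    (h : DifferentiableAt ℝ ψ x) :
    twistedDeriv θ ψ x = fderiv ℝ ψ x (1, -deriv θ x.1 * x.2.2, deriv θ x.1 * x.2.1) := by
  have hv : ((1 : ℝ), -deriv θ x.1 * x.2.2, deriv θ x.1 * x.2.1) =
      (1, 0, 0) + ((-deriv θ x.1 * x.2.2) • ((0 : ℝ), (1 : ℝ), (0 : ℝ)) +
        (deriv θ x.1 * x.2.1) • ((0 : ℝ), (0 : ℝ), (1 : ℝ))) := by
    ext <;> simp
  rw [hv, map_add, map_add, map_smul, map_smul, twistedDeriv, pdtau, pd1_eq_fderiv h,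
    pd2_eq_fderiv h, pd3_eq_fderiv h]
  module

lemma continuous_twistedDeriv {θ : ℝ → ℝ} (hθ : ContDiff ℝ 1 θ) {ψ : ℝ × ℝ × ℝ → ℂ}
    (hψ : ContDiff ℝ (⊤ : ℕ∞) ψ) : Continuous (twistedDeriv θ ψ) := by
  have hd : Differentiable ℝ ψ := hψ.differentiable (by simp)
  have h : twistedDeriv θ ψ = fun x =>
      fderiv ℝ ψ x (1, -deriv θ x.1 * x.2.2, deriv θ x.1 * x.2.1) :=
    funext fun x => twistedDeriv_eq_fderiv (hd x)
  have hc : Continuous (fderiv ℝ ψ) := hψ.continuous_fderiv (by simp)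
  have hθc : Continuous (deriv θ) := hθ.continuous_deriv le_rfl
  rw [h]
  fun_prop

lemma twistedDeriv_eq_zero {θ : ℝ → ℝ} {ω : Set (ℝ × ℝ)} {ψ : ℝ × ℝ × ℝ → ℂ}
    (hψ : IsTest3 (Omega0 ω) ψ) {x : ℝ × ℝ × ℝ} (hx : x.2 ∉ ω) : twistedDeriv θ ψ x = 0 := by
  rw [twistedDeriv_eq_fderiv ((hψ.1.differentiable (by simp)) x),
    fderiv_of_notMem_tsupport ℝ fun h => hx (hψ.2.2 h)]
  rfl

lemma hasDerivAt_comp_rot {θ : ℝ → ℝ} (hθ : Differentiable ℝ θ) {ψ : ℝ × ℝ × ℝ → ℂ}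
    (hψ : Differentiable ℝ ψ) (s : ℝ) (p : ℝ × ℝ) :
    HasDerivAt (fun s => ψ (s, rot (-θ s) p)) (twistedDeriv θ ψ (s, rot (-θ s) p)) s := by
  rw [twistedDeriv_eq_fderiv (hψ _)]
  refine HasFDerivAt.comp_hasDerivAt (f := fun s => (s, rot (-θ s) p)) s (hψ _).hasFDerivAt
    ((hasDerivAt_id s).prodMk (HasDerivAt.prodMk ?_ ?_))
  · have h := (((hθ s).hasDerivAt.neg.cos).const_mul p.1).add
      (((hθ s).hasDerivAt.neg.sin).const_mul p.2)
    refine h.congr_deriv ?_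
    simp only [rot, Pi.neg_apply]
    ring
  · have h := (((hθ s).hasDerivAt.neg.sin).const_mul (-p.1)).add
      (((hθ s).hasDerivAt.neg.cos).const_mul p.2)
    refine h.congr_deriv ?_
    simp only [rot, Pi.neg_apply]
    ring

lemma isBounded_euclideanDisc (R : ℝ) :
    Bornology.IsBounded {p : ℝ × ℝ | p.1 ^ 2 + p.2 ^ 2 ≤ R} := by
  refine (Metric.isBounded_closedBall (x := (0 : ℝ × ℝ)) (r := R + 1)).subset fun p hp => ?_
  have h : p.1 ^ 2 + p.2 ^ 2 ≤ R := hp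
  rw [mem_closedBall_zero_iff, Prod.norm_def, sup_le_iff, Real.norm_eq_abs, Real.norm_eq_abs,
    abs_le, abs_le]
  refine ⟨⟨?_, ?_⟩, ?_, ?_⟩ <;>
    nlinarith [sq_nonneg p.1, sq_nonneg p.2, sq_nonneg (p.1 - 1), sq_nonneg (p.2 - 1),
      sq_nonneg (p.1 + 1), sq_nonneg (p.2 + 1)]

lemma rot_preimage_euclideanDisc (α R : ℝ) :
    rot α ⁻¹' {p : ℝ × ℝ | p.1 ^ 2 + p.2 ^ 2 ≤ R} = {p : ℝ × ℝ | p.1 ^ 2 + p.2 ^ 2 ≤ R} := by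
  ext p
  simp only [mem_preimage, mem_ofPred_eq, rot]
  rw [show (p.1 * Real.cos α + p.2 * Real.sin α) ^ 2 + (-p.1 * Real.sin α + p.2 * Real.cos α) ^ 2 =
    (p.1 ^ 2 + p.2 ^ 2) * (Real.sin α ^ 2 + Real.cos α ^ 2) by ring, Real.sin_sq_add_cos_sq, mul_one]

lemma exists_subset_euclideanDisc {ω : Set (ℝ × ℝ)} (hω : Bornology.IsBounded ω) :
    ∃ R, ω ⊆ {p : ℝ × ℝ | p.1 ^ 2 + p.2 ^ 2 ≤ R} := by
  obtain ⟨C, hC⟩ := hω.exists_norm_le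
  refine ⟨C ^ 2 + C ^ 2, fun p hp => ?_⟩
  have h1 : |p.1| ≤ C := (norm_fst_le p).trans (hC p hp)
  have h2 : |p.2| ≤ C := (norm_snd_le p).trans (hC p hp)
  exact add_le_add (sq_le_sq' (abs_le.1 h1).1 (abs_le.1 h1).2)
    (sq_le_sq' (abs_le.1 h2).1 (abs_le.1 h2).2)

lemma setIntegral_rot_preimage (α : ℝ) (f : ℝ × ℝ → ℝ) (s : Set (ℝ × ℝ)) :
    ∫ p in rot α ⁻¹' s, f (rot α p) = ∫ p in s, f p :=
  (measurePreserving_rot α).setIntegral_preimage_emb (measurableEmbedding_rot α) f s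

/-- In the frame rotating with the twist, a test function varies by at most the longitudinal
energy between two cross-sections. -/
lemma setIntegral_normSq_sub_le {θ : ℝ → ℝ} (hθ : ContDiff ℝ 1 θ) {ω : Set (ℝ × ℝ)}
    {ψ : ℝ × ℝ × ℝ → ℂ} (hψ : IsTest3 (Omega0 ω) ψ) {R a b s t : ℝ}
    (hR : ω ⊆ {p : ℝ × ℝ | p.1 ^ 2 + p.2 ^ 2 ≤ R}) (hs : s ∈ Ioo a b) (ht : t ∈ Ioo a b) :
    ∫ p in {p : ℝ × ℝ | p.1 ^ 2 + p.2 ^ 2 ≤ R},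
        ‖ψ (s, rot (-θ s) p) - ψ (t, rot (-θ t) p)‖ ^ 2 ≤
      (b - a) * ∫ x in Ioo a b ×ˢ ω, ‖twistedDeriv θ ψ x‖ ^ 2 := by
  set B := {p : ℝ × ℝ | p.1 ^ 2 + p.2 ^ 2 ≤ R} with hB
  have hBb : Bornology.IsBounded B := isBounded_euclideanDisc R
  have hBm : MeasurableSet B := (isClosed_le (by fun_prop) continuous_const).measurableSet
  have hψc := hψ.1.continuous
  have hDc := continuous_twistedDeriv hθ hψ.1
  have hrc : Continuous fun q : ℝ × ℝ × ℝ => rot (-θ q.1) q.2 :=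
    continuous_rot.comp (f := fun q : ℝ × ℝ × ℝ => (-θ q.1, q.2))
      ((hθ.continuous.comp continuous_fst).neg.prodMk continuous_snd)
  have hrc' : ∀ r, Continuous (rot r) := continuous_rot_right
  have hGc : Continuous fun q : ℝ × ℝ × ℝ =>
      ‖twistedDeriv θ ψ (q.1, rot (-θ q.1) q.2)‖ ^ 2 :=
    (hDc.comp (continuous_fst.prodMk hrc)).norm.pow 2
  have hInt : IntegrableOn (fun q : ℝ × ℝ × ℝ => ‖twistedDeriv θ ψ (q.1, rot (-θ q.1) q.2)‖ ^ 2)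
      (Ioo a b ×ˢ B) := integrableOn_of_continuous_of_isBounded hGc
        ((Metric.isBounded_Ioo a b).prod hBb)
  have hintp : Integrable (fun q : ℝ × ℝ × ℝ => ‖twistedDeriv θ ψ (q.1, rot (-θ q.1) q.2)‖ ^ 2)
      ((volume.restrict (Ioo a b)).prod (volume.restrict B)) := by
    rw [Measure.prod_restrict]
    exact hInt
  have hint2 : IntegrableOn (fun x => ‖twistedDeriv θ ψ x‖ ^ 2) (Ioo a b ×ˢ B) :=
    integrableOn_of_continuous_of_isBounded (hDc.norm.pow 2) ((Metric.isBounded_Ioo a b).prod hBb)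
  have hpt : ∀ p, ‖ψ (s, rot (-θ s) p) - ψ (t, rot (-θ t) p)‖ ^ 2 ≤
      (b - a) * ∫ r in Ioo a b, ‖twistedDeriv θ ψ (r, rot (-θ r) p)‖ ^ 2 := fun p =>
    normSq_sub_le_setIntegral (F := fun s => ψ (s, rot (-θ s) p))
      (fun r => hasDerivAt_comp_rot (hθ.differentiable one_ne_zero) (hψ.1.differentiable (by simp)) r p)
      (hDc.comp (continuous_id.prodMk (hrc.comp (Continuous.prodMk_left p)))) hs ht
  calc ∫ p in B, ‖ψ (s, rot (-θ s) p) - ψ (t, rot (-θ t) p)‖ ^ 2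
      ≤ ∫ p in B, (b - a) * ∫ r in Ioo a b, ‖twistedDeriv θ ψ (r, rot (-θ r) p)‖ ^ 2 := by
        refine integral_mono (integrableOn_of_continuous_of_isBounded ?_ hBb)
          (hintp.integral_prod_right.const_mul _) hpt
        have h1 : Continuous fun p => ψ (s, rot (-θ s) p) :=
          hψc.comp (continuous_const.prodMk (hrc' _))
        have h2 : Continuous fun p => ψ (t, rot (-θ t) p) :=
          hψc.comp (continuous_const.prodMk (hrc' _))
        fun_prop
    _ = (b - a) * ∫ r in Ioo a b, ∫ p in B, ‖twistedDeriv θ ψ (r, rot (-θ r) p)‖ ^ 2 := by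
        rw [integral_const_mul, integral_integral_swap
          (f := fun r p => ‖twistedDeriv θ ψ (r, rot (-θ r) p)‖ ^ 2) hintp]
    _ = (b - a) * ∫ r in Ioo a b, ∫ p in B, ‖twistedDeriv θ ψ (r, p)‖ ^ 2 := by
        congr 1
        refine integral_congr_ae (ae_of_all _ fun r => ?_)
        have h := setIntegral_rot_preimage (-θ r) (fun p => ‖twistedDeriv θ ψ (r, p)‖ ^ 2) B
        rwa [rot_preimage_euclideanDisc] at h
    _ = (b - a) * ∫ x in Ioo a b ×ˢ B, ‖twistedDeriv θ ψ x‖ ^ 2 := by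
        exact congrArg _ (setIntegral_prod _ hint2).symm
    _ = (b - a) * ∫ x in Ioo a b ×ˢ ω, ‖twistedDeriv θ ψ x‖ ^ 2 := by
        congr 1
        refine setIntegral_eq_of_subset_of_forall_sdiff_eq_zero
          (measurableSet_Ioo.prod hBm) (prod_mono_right hR) fun x hx => ?_
        rw [twistedDeriv_eq_zero hψ fun h => hx.2 ⟨hx.1.1, h⟩]
        simp

lemma IsTest3.slice {ω : Set (ℝ × ℝ)} {ψ : ℝ × ℝ × ℝ → ℂ} (hψ : IsTest3 (Omega0 ω) ψ) (s : ℝ) :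
    IsTest2 ω fun p => ψ (s, p) := by
  have hsub : tsupport (fun p => ψ (s, p)) ⊆ Prod.mk s ⁻¹' tsupport ψ :=
    closure_minimal (fun p hp => subset_tsupport ψ hp)
      ((isClosed_tsupport ψ).preimage (Continuous.prodMk_right s))
  refine ⟨hψ.1.comp (contDiff_prodMk_right s), ?_, fun p hp => hψ.2.2 (hsub hp)⟩
  exact (hψ.2.1.isCompact.image continuous_snd).of_isClosed_subset (isClosed_tsupport _)
    fun p hp => ⟨(s, p), hsub hp, rfl⟩

lemma continuous_gradSq_slice {ψ : ℝ × ℝ × ℝ → ℂ} (hψ : ContDiff ℝ (⊤ : ℕ∞) ψ) :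
    Continuous fun x : ℝ × ℝ × ℝ => gradSq (fun p => ψ (x.1, p)) x.2 := by
  have hd : Differentiable ℝ ψ := hψ.differentiable (by simp)
  have h : (fun x : ℝ × ℝ × ℝ => gradSq (fun p => ψ (x.1, p)) x.2) =
      fun x => ‖fderiv ℝ ψ x (0, 1, 0)‖ ^ 2 + ‖fderiv ℝ ψ x (0, 0, 1)‖ ^ 2 := by
    funext x
    rw [← pd2_eq_fderiv (hd x), ← pd3_eq_fderiv (hd x)]
    rfl
  have hc : Continuous (fderiv ℝ ψ) := hψ.continuous_fderiv (by simp)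
  rw [h]
  fun_prop

lemma QformI_eq {θ : ℝ → ℝ} (hθ : ContDiff ℝ 1 θ) {ω : Set (ℝ × ℝ)} (hω : Bornology.IsBounded ω)
    {ψ : ℝ × ℝ × ℝ → ℂ} (hψ : ContDiff ℝ (⊤ : ℕ∞) ψ) (a b : ℝ) :
    QformI θ ω (Ioo a b) ψ = (∫ x in Ioo a b ×ˢ ω, ‖twistedDeriv θ ψ x‖ ^ 2) +
      ∫ s in Ioo a b, ∫ p in ω, gradSq (fun p => ψ (s, p)) p := by
  have hb := (Metric.isBounded_Ioo a b).prod hω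
  have h2 : IntegrableOn (fun x : ℝ × ℝ × ℝ => gradSq (fun p => ψ (x.1, p)) x.2)
      (Ioo a b ×ˢ ω) := integrableOn_of_continuous_of_isBounded (continuous_gradSq_slice hψ) hb
  have h3 : ∫ s in Ioo a b, ∫ p in ω, gradSq (fun p => ψ (s, p)) p =
      ∫ x in Ioo a b ×ˢ ω, gradSq (fun p => ψ (x.1, p)) x.2 := (setIntegral_prod _ h2).symm
  have hDc := continuous_twistedDeriv hθ hψ
  have h1 : IntegrableOn (fun x => ‖twistedDeriv θ ψ x‖ ^ 2) (Ioo a b ×ˢ ω) :=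
    integrableOn_of_continuous_of_isBounded (by fun_prop) hb
  rw [h3, ← integral_add h1 h2]
  exact integral_congr_ae (ae_of_all _ fun x => add_assoc _ _ _)

lemma setIntegral_normSq_slice_diff_le {θ : ℝ → ℝ} (hθ : ContDiff ℝ 1 θ) {ω : Set (ℝ × ℝ)}
    (hω : MeasurableSet ω) (hω_bdd : Bornology.IsBounded ω) {ψ : ℝ × ℝ × ℝ → ℂ}
    (hψ : IsTest3 (Omega0 ω) ψ) {a b s t : ℝ} (hs : s ∈ Ioo a b) (ht : t ∈ Ioo a b) :
    ∫ p in ω \ rot (θ s - θ t) ⁻¹' ω, ‖ψ (s, p)‖ ^ 2 ≤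
      (b - a) * ∫ x in Ioo a b ×ˢ ω, ‖twistedDeriv θ ψ x‖ ^ 2 := by
  obtain ⟨R, hR⟩ := exists_subset_euclideanDisc hω_bdd
  have hψc := hψ.1.continuous
  have hrc := continuous_rot_right
  have hcomp : ∀ p, rot (θ s - θ t) (rot (-θ s) p) = rot (-θ t) p := fun p => by
    rw [rot_rot, sub_add_eq_add_sub, add_neg_cancel, zero_sub]
  rw [← setIntegral_rot_preimage (-θ s)]
  set D := rot (-θ s) ⁻¹' (ω \ rot (θ s - θ t) ⁻¹' ω) with hD
  have hDm : MeasurableSet D := (hrc _).measurable (hω.diff ((hrc _).measurable hω))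
  have hDB : D ⊆ {p : ℝ × ℝ | p.1 ^ 2 + p.2 ^ 2 ≤ R} := by
    rw [← rot_preimage_euclideanDisc (-θ s)]
    exact fun p hp => hR hp.1
  have h1 : Continuous fun p => ψ (s, rot (-θ s) p) :=
    hψc.comp (continuous_const.prodMk (hrc _))
  have h2 : Continuous fun p => ψ (t, rot (-θ t) p) :=
    hψc.comp (continuous_const.prodMk (hrc _))
  refine le_trans (le_of_eq ?_) ((setIntegral_mono_set (integrableOn_of_continuous_of_isBounded
    (by fun_prop) (isBounded_euclideanDisc R)) (ae_of_all _ fun p => by positivity)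
    hDB.eventuallyLE).trans (setIntegral_normSq_sub_le hθ hψ hR hs ht))
  refine setIntegral_congr_fun hDm fun p hp => ?_
  have h0 : ψ (t, rot (-θ t) p) = 0 := by
    refine image_eq_zero_of_notMem_tsupport fun h => hp.2 ?_
    rw [mem_preimage, hcomp]
    exact hψ.2.2 h
  simp only [h0, sub_zero]

lemma setIntegral_normSq_le_two_mul_add {B : Set (ℝ × ℝ)} (hB : Bornology.IsBounded B)
    {u v : ℝ × ℝ → ℂ} (hu : Continuous u) (hv : Continuous v) :
    ∫ p in B, ‖v p‖ ^ 2 ≤ 2 * (∫ p in B, ‖u p‖ ^ 2) + 2 * ∫ p in B, ‖u p - v p‖ ^ 2 := by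
  rw [← integral_const_mul, ← integral_const_mul, ← integral_add
    (integrableOn_of_continuous_of_isBounded (by fun_prop) hB)
    (integrableOn_of_continuous_of_isBounded (by fun_prop) hB)]
  refine integral_mono (integrableOn_of_continuous_of_isBounded (by fun_prop) hB)
    (integrableOn_of_continuous_of_isBounded (by fun_prop) hB) fun p => ?_
  have h1 := norm_sub_norm_le (v p) (u p)
  rw [norm_sub_rev] at h1
  dsimp only
  nlinarith [norm_nonneg (v p), norm_nonneg (u p), norm_nonneg (u p - v p),
    sq_nonneg (‖u p‖ - ‖u p - v p‖)]

lemma setIntegral_normSq_slice_le {θ : ℝ → ℝ} (hθ : ContDiff ℝ 1 θ) {ω : Set (ℝ × ℝ)}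
    (hω_bdd : Bornology.IsBounded ω) {ψ : ℝ × ℝ × ℝ → ℂ}
    (hψ : IsTest3 (Omega0 ω) ψ) {a b s t : ℝ} (hs : s ∈ Ioo a b) (ht : t ∈ Ioo a b) :
    ∫ p in ω, ‖ψ (t, p)‖ ^ 2 ≤ 2 * (∫ p in ω, ‖ψ (s, p)‖ ^ 2) +
      2 * ((b - a) * ∫ x in Ioo a b ×ˢ ω, ‖twistedDeriv θ ψ x‖ ^ 2) := by
  obtain ⟨R, hR⟩ := exists_subset_euclideanDisc hω_bdd
  have hψc := hψ.1.continuous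
  set B := {p : ℝ × ℝ | p.1 ^ 2 + p.2 ^ 2 ≤ R} with hB
  have hBb : Bornology.IsBounded B := isBounded_euclideanDisc R
  have hBm : MeasurableSet B := (isClosed_le (by fun_prop) continuous_const).measurableSet
  have hslice : ∀ r, ∫ p in ω, ‖ψ (r, p)‖ ^ 2 = ∫ p in B, ‖ψ (r, rot (-θ r) p)‖ ^ 2 := by
    intro r
    have h := setIntegral_rot_preimage (-θ r) (fun p => ‖ψ (r, p)‖ ^ 2) B
    rw [rot_preimage_euclideanDisc] at h
    rw [h]
    refine (setIntegral_eq_of_subset_of_forall_sdiff_eq_zero hBm hR fun p hp => ?_).symm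
    rw [image_eq_zero_of_notMem_tsupport fun h => hp.2 (hψ.2.2 h)]
    simp
  have hc : ∀ r, Continuous fun p => ψ (r, rot (-θ r) p) := fun r =>
    hψc.comp (continuous_const.prodMk (continuous_rot_right _))
  have h := setIntegral_normSq_sub_le hθ hψ hR hs ht
  rw [hslice, hslice]
  refine le_trans ?_ (add_le_add_right (mul_le_mul_of_nonneg_left h zero_le_two) _)
  exact setIntegral_normSq_le_two_mul_add hBb (hc s) (hc t)

lemma setIntegral_prod_normSq_le {θ : ℝ → ℝ} (hθ : ContDiff ℝ 1 θ) {ω : Set (ℝ × ℝ)}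
    (hω_bdd : Bornology.IsBounded ω) {ψ : ℝ × ℝ × ℝ → ℂ}
    (hψ : IsTest3 (Omega0 ω) ψ) {a b s : ℝ} (hs : s ∈ Ioo a b) :
    ∫ x in Ioo a b ×ˢ ω, ‖ψ x‖ ^ 2 ≤ (b - a) * (2 * (∫ p in ω, ‖ψ (s, p)‖ ^ 2) +
      2 * ((b - a) * ∫ x in Ioo a b ×ˢ ω, ‖twistedDeriv θ ψ x‖ ^ 2)) := by
  have hψc := hψ.1.continuous
  have hInt : IntegrableOn (fun x => ‖ψ x‖ ^ 2) (Ioo a b ×ˢ ω) :=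
    integrableOn_of_continuous_of_isBounded (by fun_prop) ((Metric.isBounded_Ioo a b).prod hω_bdd)
  have hintp : Integrable (fun x : ℝ × ℝ × ℝ => ‖ψ x‖ ^ 2)
      ((volume.restrict (Ioo a b)).prod (volume.restrict ω)) := by
    rw [Measure.prod_restrict]
    exact hInt
  refine (setIntegral_prod _ hInt).trans_le ((setIntegral_mono_on hintp.integral_prod_left
    (integrable_const _) measurableSet_Ioo fun t ht =>
      setIntegral_normSq_slice_le hθ hω_bdd hψ hs ht).trans_eq ?_)
  rw [setIntegral_const, smul_eq_mul, Real.volume_real_Ioo_of_le (hs.1.trans hs.2).le]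

lemma volume_diff_rot_preimage (ω : Set (ℝ × ℝ)) (α β : ℝ) :
    volume (ω \ rot (α - β) ⁻¹' ω) = volume ((rot (-α) ⁻¹' ω) \ (rot (-β) ⁻¹' ω)) := by
  rw [← (measurePreserving_rot (-α)).measure_preimage_emb (measurableEmbedding_rot _),
    preimage_sdiff, ← preimage_comp]
  have h : rot (α - β) ∘ rot (-α) = rot (-β) := funext fun p => by
    rw [Function.comp, rot_rot, sub_add_eq_add_sub, add_neg_cancel, zero_sub]
  rw [h]

lemma exists_isTest3_setIntegral_pos {ω : Set (ℝ × ℝ)} (hω : IsOpen ω)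
    (hω_bdd : Bornology.IsBounded ω) (hω_ne : ω.Nonempty) {a b : ℝ} (hab : a < b) :
    ∃ ψ : ℝ × ℝ × ℝ → ℂ, IsTest3 (Omega0 ω) ψ ∧ 0 < ∫ x in Ioo a b ×ˢ ω, ‖ψ x‖ ^ 2 := by
  obtain ⟨p, hp⟩ := hω_ne
  obtain ⟨s, hs⟩ := nonempty_Ioo.2 hab
  have hU : IsOpen (Ioo a b ×ˢ ω) := isOpen_Ioo.prod hω
  obtain ⟨f, hf, hfc, hfs, -, hf1⟩ := exists_contDiff_tsupport_subset (n := (⊤ : ℕ∞))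
    (hU.mem_nhds (show (s, p) ∈ Ioo a b ×ˢ ω from ⟨hs, hp⟩))
  set ψ : ℝ × ℝ × ℝ → ℂ := fun x => (f x : ℂ) with hψdef
  have hsub : tsupport ψ ⊆ tsupport f :=
    closure_mono fun x hx h => hx (by simp only [hψdef, h, Complex.ofReal_zero])
  have hψ : ContDiff ℝ (⊤ : ℕ∞) ψ := Complex.ofRealCLM.contDiff.comp hfs
  have hψc := hψ.continuous
  refine ⟨ψ, ⟨hψ, hfc.of_isClosed_subset (isClosed_tsupport _) hsub,
    fun x hx => (hf (hsub hx)).2⟩, ?_⟩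
  rw [setIntegral_pos_iff_support_of_nonneg_ae (ae_of_all _ fun x => by positivity)
    (integrableOn_of_continuous_of_isBounded (by fun_prop)
      ((Metric.isBounded_Ioo a b).prod hω_bdd))]
  have ho : IsOpen (Function.support (fun x => ‖ψ x‖ ^ 2) ∩ Ioo a b ×ˢ ω) :=
    (Continuous.isOpen_support (by fun_prop)).inter hU
  exact ho.measure_pos volume ⟨(s, p), by simp [hψdef, hf1], hs, hp⟩

/-- For a non-null set of longitudinal positions `s`, the cross-sectional form plus the indicator
of the part of `ω` leaving `ω` after a suitable rotation has a uniform spectral gap over `E1 ω`. -/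
lemma exists_volume_ne_zero_forall_mul_setIntegral_le {ω : Set (ℝ × ℝ)} (hω : IsOpen ω)
    (hω_bdd : Bornology.IsBounded ω) (hω_conn : IsConnected ω) {θ : ℝ → ℝ} (hθ : Continuous θ)
    {a b : ℝ} (hθI : ∃ s ∈ Ioo a b, ∃ t ∈ Ioo a b, θ s ≠ θ t)
    (hrot : ∃ ϑ ∈ Ioo (0 : ℝ) (2 * Real.pi), volume (symmDiff (rot ϑ '' ω) ω) ≠ 0) :
    ∃ δ > 0, ∃ t ∈ Ioo a b, ∃ S ⊆ Ioo a b, volume S ≠ 0 ∧ ∀ s ∈ S, ∀ g, IsTest2 ω g →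
      δ * ∫ p in ω, ‖g p‖ ^ 2 ≤ ((∫ p in ω, gradSq g p) - E1 ω * ∫ p in ω, ‖g p‖ ^ 2) +
        ∫ p in ω \ rot (θ s - θ t) ⁻¹' ω, ‖g p‖ ^ 2 := by
  obtain ⟨s₀, hs₀, t, ht, hst⟩ := exists_volume_rot_preimage_diff_ne_zero hθ hθI hrot
  let S : ℕ → Set ℝ := fun n => {s ∈ Ioo a b | ∀ g, IsTest2 ω g →
    1 / ((n : ℝ) + 1) * ∫ p in ω, ‖g p‖ ^ 2 ≤
      ((∫ p in ω, gradSq g p) - E1 ω * ∫ p in ω, ‖g p‖ ^ 2) +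
        ∫ p in ω \ rot (θ s - θ t) ⁻¹' ω, ‖g p‖ ^ 2}
  have hmem : (⋃ n, S n) ∈ nhds s₀ := by
    filter_upwards [eventually_volume_rot_preimage_diff_ne_zero hω hθ hst,
      isOpen_Ioo.mem_nhds hs₀] with s hs hsI
    rw [← volume_diff_rot_preimage] at hs
    obtain ⟨δ, hδ, h⟩ := exists_mul_setIntegral_le hω hω_bdd hω_conn
      (hω.measurableSet.diff ((continuous_rot_right _).measurable hω.measurableSet))
      sdiff_subset hs
    obtain ⟨n, hn⟩ := exists_nat_one_div_lt hδ
    refine mem_iUnion.2 ⟨n, hsI, fun g hg => le_trans ?_ (h g hg)⟩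
    exact mul_le_mul_of_nonneg_right hn.le (by positivity)
  obtain ⟨n, hn⟩ : ∃ n, volume (S n) ≠ 0 := by
    by_contra! h0
    exact (Measure.measure_pos_of_mem_nhds volume hmem).ne' (measure_iUnion_null h0)
  exact ⟨1 / ((n : ℝ) + 1), by positivity, t, ht, S n, sep_subset _ _, hn, fun s hs => hs.2⟩

lemma mul_measureReal_le_setIntegral {q : ℝ → ℝ} {a b ε : ℝ} (hq : IntegrableOn q (Ioo a b))
    (hq0 : ∀ s, 0 ≤ q s) {S : Set ℝ} (hS : S ⊆ Ioo a b) (hSq : ∀ s ∈ S, ε ≤ q s) :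
    volume.real S * ε ≤ ∫ s in Ioo a b, q s := by
  rcases le_or_gt ε 0 with h | h
  · exact (mul_nonpos_of_nonneg_of_nonpos measureReal_nonneg h).trans (integral_nonneg hq0)
  · refine le_trans ?_ (mul_meas_ge_le_integral_of_nonneg (ae_of_all _ hq0) hq ε)
    rw [mul_comm]
    refine mul_le_mul_of_nonneg_left (ENNReal.toReal_mono (measure_ne_top _ _) ?_) h.le
    have hsub : S ⊆ {s | ε ≤ q s} ∩ Ioo a b := fun s hs => ⟨hSq s hs, hS hs⟩
    exact (measure_mono hsub).trans (Measure.le_restrict_apply _ _)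

/-- if θ is not constant on the bounded interval I = (a,b) and ω is not
rotationally symmetric about the origin (strong form), then λ(θ̇, I) > 0. -/
theorem lam_pos_of_twisted_on_interval
    (ω : Set (ℝ × ℝ)) (hω_open : IsOpen ω) (hω_bdd : Bornology.IsBounded ω)
    (hω_conn : IsConnected ω)
    (θ : ℝ → ℝ) (hθ : ContDiff ℝ 1 θ) (hθ' : ∃ M : ℝ, ∀ t : ℝ, |deriv θ t| ≤ M)
    (a b : ℝ) (hab : a < b)
    (hθI : ∃ s ∈ Set.Ioo a b, ∃ t ∈ Set.Ioo a b, θ s ≠ θ t)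
    (hrot : ∃ ϑ ∈ Set.Ioo (0 : ℝ) (2 * Real.pi),
      volume (symmDiff (rot ϑ '' ω) ω) ≠ 0) :
    0 < lam θ ω (Set.Ioo a b) := by
  obtain ⟨δ, hδ, t, ht, S, hSI, hS0, hS⟩ := exists_volume_ne_zero_forall_mul_setIntegral_le
    hω_open hω_bdd hω_conn hθ.continuous hθI hrot
  have hba : 0 < b - a := sub_pos.2 hab
  have hm : 0 < volume.real S := ENNReal.toReal_pos hS0
    (measure_ne_top_of_subset hSI measure_Ioo_lt_top.ne)
  set m := volume.real S with hm_def
  set κ := δ / (2 * (b - a)) with hκ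
  have hκ0 : 0 < κ := by positivity
  set C := (δ + 1) * (b - a) with hC
  have hC0 : 0 < C := by positivity
  have hgap : 0 < m * κ / (1 + m * C) := by positivity
  refine hgap.trans_le (le_csInf ?_ ?_)
  · obtain ⟨ψ, hψ, hpos⟩ := exists_isTest3_setIntegral_pos hω_open hω_bdd hω_conn.nonempty hab
    exact ⟨_, ψ, hψ, hpos, rfl⟩
  rintro _ ⟨ψ, hψ, hpos, rfl⟩
  have hψc := hψ.1.continuous
  rw [le_div_iff₀ hpos, QformI_eq hθ hω_bdd hψ.1]
  set A := ∫ x in Ioo a b ×ˢ ω, ‖twistedDeriv θ ψ x‖ ^ 2 with hA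
  set N := ∫ x in Ioo a b ×ˢ ω, ‖ψ x‖ ^ 2 with hN
  have hA0 : 0 ≤ A := by positivity
  have hb := (Metric.isBounded_Ioo a b).prod hω_bdd
  have hprod : ∀ {f : ℝ × ℝ × ℝ → ℝ}, Continuous f →
      IntegrableOn (fun s => ∫ p in ω, f (s, p)) (Ioo a b) := fun {f} hf => by
    have h : Integrable f ((volume.restrict (Ioo a b)).prod (volume.restrict ω)) := by
      rw [Measure.prod_restrict]
      exact integrableOn_of_continuous_of_isBounded hf hb
    exact h.integral_prod_left
  have hint1 : IntegrableOn (fun s => ∫ p in ω, gradSq (fun p => ψ (s, p)) p) (Ioo a b) :=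
    hprod (continuous_gradSq_slice hψ.1)
  have hint2 : IntegrableOn (fun s => ∫ p in ω, ‖ψ (s, p)‖ ^ 2) (Ioo a b) :=
    hprod (f := fun x => ‖ψ x‖ ^ 2) (by fun_prop)
  have hNeq : N = ∫ s in Ioo a b, ∫ p in ω, ‖ψ (s, p)‖ ^ 2 :=
    setIntegral_prod (fun x => ‖ψ x‖ ^ 2) (integrableOn_of_continuous_of_isBounded
      (by fun_prop) hb)
  have hmain := mul_measureReal_le_setIntegral (ε := κ * N - C * A)
    (q := fun s => (∫ p in ω, gradSq (fun p => ψ (s, p)) p) - E1 ω * ∫ p in ω, ‖ψ (s, p)‖ ^ 2)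
    (hint1.sub (hint2.const_mul _)) (fun s => sub_nonneg.2 (E1_mul_le ω (hψ.slice s))) hSI
    fun s hs => by
      have h1 := hS s hs _ (hψ.slice s)
      have h2 := setIntegral_normSq_slice_diff_le hθ hω_open.measurableSet hω_bdd hψ (hSI hs) ht
      have h3 := setIntegral_prod_normSq_le hθ hω_bdd hψ (hSI hs)
      rw [← hA] at h2 h3
      have h4 : κ * N ≤ δ * (∫ p in ω, ‖ψ (s, p)‖ ^ 2) + δ * ((b - a) * A) := by
        refine (mul_le_mul_of_nonneg_left h3 hκ0.le).trans_eq ?_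
        rw [hκ]
        field_simp
      rw [hC]
      linarith
  rw [integral_sub hint1 (hint2.const_mul _), integral_const_mul, ← hNeq] at hmain
  rw [div_mul_eq_mul_div, div_le_iff₀ (by positivity)]
  set G := ∫ s in Ioo a b, ∫ p in ω, gradSq (fun p => ψ (s, p)) p with hG
  have hP : 0 ≤ G - E1 ω * N := by
    rw [hNeq, hG, ← integral_const_mul, ← integral_sub hint1 (hint2.const_mul _)]
    exact integral_nonneg fun s => sub_nonneg.2 (E1_mul_le ω (hψ.slice s))
  nlinarith [mul_nonneg (mul_pos hm hC0).le hP]
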